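/- arXiv:2201.09994 — 2 statements merged into one kernel-verified Lean document; each statement's English description precedes it below -/
import Mathlib

section
/- Let I ⊂ S be a homogeneous ideal of height c ≥ 2 with a d-linear free resolution of S/I of projective dimension p. Then μ(I) ≥ max{ p, C(d + c − 1, c − 1) } and β_c(S/I) ≥ max{ C(p, c), C(d + c − 2, c − 1) }. -/
/-- The free graded module with `b j` generators in degree `j` (i.e. `⊕_j A(-j)^{b j}`). -/
abbrev FreeMod (A : Type*) [CommRing A] (b : ℤ → ℕ) : Type _ :=
  ((j : ℤ) × Fin (b j)) →₀ A

/-- A minimal graded free resolution of the module `M` over the (graded) commutative ring `A`,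
where `hom m` is the set of homogeneous elements of degree `m` of `A`.  The data records the
graded Betti numbers `β i j` (the number of copies of `A(-j)` in homological degree `i`),
the differentials and the augmentation; the conditions say that the differentials are graded of
degree `0` (the entries of their matrices are homogeneous of the appropriate degree), that the
resolution is minimal (all entries have positive degree, equivalently lie in the irrelevant
maximal ideal), and that the complex is exact, resolving `M`. -/
structure MinGradedFreeRes (A : Type*) [CommRing A] (hom : ℕ → Set A)
    (M : Type*) [AddCommGroup M] [Module A M] where
  β : ℕ → ℤ → ℕ
  finβ : ∀ i, (Function.support (β i)).Finite
  d : ∀ i, FreeMod A (β (i + 1)) →ₗ[A] FreeMod A (β i)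
  aug : FreeMod A (β 0) →ₗ[A] M
  graded : ∀ (i : ℕ) (j : ℤ) (a : Fin (β (i + 1) j)) (j' : ℤ) (a' : Fin (β i j')),
      d i (Finsupp.single ⟨j, a⟩ 1) ⟨j', a'⟩ = 0 ∨
      ∃ m : ℕ, (m : ℤ) = j - j' ∧ d i (Finsupp.single ⟨j, a⟩ 1) ⟨j', a'⟩ ∈ hom m
  minimal : ∀ (i : ℕ) (j : ℤ) (a : Fin (β (i + 1) j)) (j' : ℤ) (a' : Fin (β i j')),
      d i (Finsupp.single ⟨j, a⟩ 1) ⟨j', a'⟩ ≠ 0 → j' < j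
  augSurj : Function.Surjective aug
  exact₀ : LinearMap.range (d 0) = LinearMap.ker aug
  exact : ∀ i, LinearMap.range (d (i + 1)) = LinearMap.ker (d i)

/-- The `i`-th total Betti number of a resolution. -/
noncomputable def MinGradedFreeRes.tB {A : Type*} [CommRing A] {hom : ℕ → Set A}
    {M : Type*} [AddCommGroup M] [Module A M]
    (res : MinGradedFreeRes A hom M) (i : ℕ) : ℕ :=
  ∑ j ∈ (res.finβ i).toFinset, res.β i j

/-- The height of an ideal: the infimum of the heights of the primes containing it. -/
noncomputable def idealHeight {A : Type*} [CommRing A] (I : Ideal A) : ℕ∞ :=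
  ⨅ (P : PrimeSpectrum A) (_ : I ≤ P.asIdeal), Order.height P


namespace LinRes
noncomputable section
open MvPolynomial Matrix

lemma hc_mul {σ K : Type*} [Field K] {p : MvPolynomial σ K} {m : ℕ} (hp : p.IsHomogeneous m)
    (g : MvPolynomial σ K) (t : ℕ) :
    homogeneousComponent (m + t) (p * g) = p * homogeneousComponent t g := by
  conv_lhs => rw [← sum_homogeneousComponent g, Finset.mul_sum, map_sum]
  have h : ∀ i, homogeneousComponent (m + t) (p * homogeneousComponent i g)
      = if i = t then p * homogeneousComponent i g else 0 := by
    intro i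
    have h1 : (p * homogeneousComponent i g).IsHomogeneous (m + i) :=
      hp.mul (homogeneousComponent_isHomogeneous i g)
    rw [homogeneousComponent_of_mem h1]
    by_cases hit : i = t
    · simp [hit]
    · rw [if_neg hit, if_neg (by omega)]
  simp_rw [h]
  rw [Finset.sum_ite_eq']
  split_ifs with h2
  · rfl
  · rw [homogeneousComponent_eq_zero]
    · simp
    · simp at h2; omega

/-- homogeneous vectors -/
def HV {ι σ K : Type*} [Field K] (t : ℕ) (u : ι → MvPolynomial σ K) : Prop :=
  ∀ i, (u i).IsHomogeneous t

/-- component of vectors -/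
def hcv {ι σ K : Type*} [Field K] (t : ℕ) (u : ι → MvPolynomial σ K) :
    ι → MvPolynomial σ K := fun i => homogeneousComponent t (u i)

lemma hcv_HV {ι σ K : Type*} [Field K] (t : ℕ) (u : ι → MvPolynomial σ K) : HV t (hcv t u) :=
  fun i => homogeneousComponent_isHomogeneous t (u i)

lemma hcv_self {ι σ K : Type*} [Field K] {t : ℕ} {u : ι → MvPolynomial σ K} (h : HV t u) :
    hcv t u = u := by
  funext i; exact homogeneousComponent_eq_self (h i)

lemma hcv_mulVec {ι κ σ K : Type*} [Field K] [Fintype κ] {m : ℕ}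
    (M : Matrix ι κ (MvPolynomial σ K)) (hM : ∀ i j, (M i j).IsHomogeneous m) (t : ℕ)
    (v : κ → MvPolynomial σ K) : hcv (m + t) (M *ᵥ v) = M *ᵥ hcv t v := by
  funext i
  simp only [hcv, mulVec, dotProduct, map_sum]
  exact Finset.sum_congr rfl fun j _ => hc_mul (hM i j) _ _

lemma hcv_smul {ι σ K : Type*} [Field K] {m : ℕ}
    {y : MvPolynomial σ K} (hy : y.IsHomogeneous m) (t : ℕ)
    (v : ι → MvPolynomial σ K) : hcv (m + t) (y • v) = y • hcv t v := by
  funext i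
  simp only [hcv, Pi.smul_apply, smul_eq_mul]
  exact hc_mul hy _ _

lemma HV.mulVec {ι κ σ K : Type*} [Field K] [Fintype κ] {m : ℕ}
    {M : Matrix ι κ (MvPolynomial σ K)} (hM : ∀ i j, (M i j).IsHomogeneous m) {t : ℕ}
    {v : κ → MvPolynomial σ K} (hv : HV t v) : HV (m + t) (M *ᵥ v) := by
  rw [← hcv_self hv, ← hcv_mulVec M hM]; exact hcv_HV _ _

lemma HV.smul {ι σ K : Type*} [Field K] {m : ℕ}
    {y : MvPolynomial σ K} (hy : y.IsHomogeneous m) {t : ℕ}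
    {v : ι → MvPolynomial σ K} (hv : HV t v) : HV (m + t) (y • v) := by
  rw [← hcv_self hv, ← hcv_smul hy]; exact hcv_HV _ _

lemma HV.sub {ι σ K : Type*} [Field K] {t : ℕ}
    {u v : ι → MvPolynomial σ K} (hu : HV t u) (hv : HV t v) : HV t (u - v) :=
  fun i => (hu i).sub (hv i)

lemma HV.add {ι σ K : Type*} [Field K] {t : ℕ}
    {u v : ι → MvPolynomial σ K} (hu : HV t u) (hv : HV t v) : HV t (u + v) :=
  fun i => (hu i).add (hv i)

structure LCx (K : Type) [Field K] (r e : ℕ) where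
  ι : ℕ → Type
  fin : ∀ a, Fintype (ι a)
  D : ∀ a, Matrix (ι a) (ι (a + 1)) (MvPolynomial (Fin r) K)
  hD0 : ∀ i j, (D 0 i j).IsHomogeneous e
  hD : ∀ a i j, (D (a + 1) i j).IsHomogeneous 1
  DD : ∀ a, D a * D (a + 1) = 0
  lin : ∀ a t u, HV (t + 1) u → D a *ᵥ u = 0 → ∃ v, u = D (a + 1) *ᵥ v

attribute [instance] LCx.fin

/-- quotient by a linear form -/
structure Quo (K : Type) [Field K] (r : ℕ) where
  y : MvPolynomial (Fin (r + 1)) K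
  π : MvPolynomial (Fin (r + 1)) K →ₐ[K] MvPolynomial (Fin r) K
  s : MvPolynomial (Fin r) K →ₐ[K] MvPolynomial (Fin (r + 1)) K
  hy : y.IsHomogeneous 1
  hy0 : y ≠ 0
  hπ : ∀ t f, f.IsHomogeneous t → (π f).IsHomogeneous t
  hs : ∀ t f, f.IsHomogeneous t → (s f).IsHomogeneous t
  πs : ∀ f, π (s f) = f
  πy : π y = 0
  hdiv : ∀ f, ∃ g, f = s (π f) + y * g

section
variable {K : Type} [Field K] {r : ℕ}

/-- map of vectors -/
def Quo.P (Q : Quo K r) {ι : Type} (u : ι → MvPolynomial (Fin (r + 1)) K) :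
    ι → MvPolynomial (Fin r) K := fun i => Q.π (u i)
/-- section of vectors -/
def Quo.S (Q : Quo K r) {ι : Type} (u : ι → MvPolynomial (Fin r) K) :
    ι → MvPolynomial (Fin (r + 1)) K := fun i => Q.s (u i)

variable (Q : Quo K r) {ι κ : Type} [Fintype κ]

lemma Quo.P_mulVec (M : Matrix ι κ (MvPolynomial (Fin (r + 1)) K)) (v) :
    Q.P (M *ᵥ v) = (M.map Q.π) *ᵥ Q.P v := by
  funext i; simp [Quo.P, Matrix.mulVec, dotProduct, map_sum]

lemma Quo.P_S (u : ι → MvPolynomial (Fin r) K) : Q.P (Q.S u) = u := by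
  funext i; exact Q.πs _

lemma Quo.P_smul (f) (u : ι → MvPolynomial (Fin (r + 1)) K) : Q.P (f • u) = Q.π f • Q.P u := by
  funext i; simp [Quo.P]

lemma Quo.P_add (u v : ι → MvPolynomial (Fin (r + 1)) K) : Q.P (u + v) = Q.P u + Q.P v := by
  funext i; simp [Quo.P]
lemma Quo.P_sub (u v : ι → MvPolynomial (Fin (r + 1)) K) : Q.P (u - v) = Q.P u - Q.P v := by
  funext i; simp [Quo.P]

lemma Quo.P_HV {t} {u : ι → MvPolynomial (Fin (r + 1)) K} (h : HV t u) : HV t (Q.P u) :=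
  fun i => Q.hπ _ _ (h i)
lemma Quo.S_HV {t} {u : ι → MvPolynomial (Fin r) K} (h : HV t u) : HV t (Q.S u) :=
  fun i => Q.hs _ _ (h i)

lemma Quo.P_zero {u : ι → MvPolynomial (Fin (r + 1)) K} (h : Q.P u = 0) : ∃ w, u = Q.y • w := by
  have : ∀ i, ∃ g, u i = Q.y * g := by
    intro i
    obtain ⟨g, hg⟩ := Q.hdiv (u i)
    have : Q.π (u i) = 0 := congrFun h i
    rw [this, map_zero, zero_add] at hg
    exact ⟨g, hg⟩
  choose g hg using this
  exact ⟨g, funext hg⟩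

lemma Quo.P_y (w : ι → MvPolynomial (Fin (r + 1)) K) : Q.P (Q.y • w) = 0 := by
  rw [Q.P_smul, Q.πy, zero_smul]

lemma Quo.y_inj {u w : ι → MvPolynomial (Fin (r + 1)) K} (h : Q.y • u = Q.y • w) : u = w := by
  funext i
  have := congrFun h i
  simp only [Pi.smul_apply, smul_eq_mul] at this
  exact mul_left_cancel₀ Q.hy0 this

lemma Quo.HV_of_y {t} {w : ι → MvPolynomial (Fin (r + 1)) K} (h : HV (t + 1) (Q.y • w)) :
    HV t w := by
  have := hcv_self h
  rw [add_comm t 1, hcv_smul Q.hy] at this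
  rw [← Q.y_inj this]; exact hcv_HV _ _

lemma LCx.lin' {e : ℕ} (X : LCx K r e) (a t u) (hu : HV (t + 1) u) (h : X.D a *ᵥ u = 0) :
    ∃ v, HV t v ∧ u = X.D (a + 1) *ᵥ v := by
  obtain ⟨v, hv⟩ := X.lin a t u hu h
  refine ⟨hcv t v, hcv_HV _ _, ?_⟩
  rw [← hcv_mulVec _ (X.hD a), add_comm 1 t, ← hv, hcv_self hu]

lemma LCx.D0' {e : ℕ} (X : LCx K r e) {t u} (hu : HV (e + t) u) {v} (h : u = X.D 0 *ᵥ v) :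
    ∃ v, HV t v ∧ u = X.D 0 *ᵥ v := by
  refine ⟨hcv t v, hcv_HV _ _, ?_⟩
  rw [← hcv_mulVec _ X.hD0, ← h, hcv_self hu]

lemma LCx.DDv {e : ℕ} (X : LCx K r e) (a v) : X.D a *ᵥ (X.D (a + 1) *ᵥ v) = 0 := by
  rw [Matrix.mulVec_mulVec, X.DD, Matrix.zero_mulVec]

lemma step_lin {e : ℕ} (X : LCx K (r + 1) e) (a t : ℕ) (u : X.ι (a + 2) → MvPolynomial (Fin r) K)
    (hu : HV (t + 1) u) (h : (X.D (a + 1)).map Q.π *ᵥ u = 0) :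
    ∃ v, u = (X.D (a + 2)).map Q.π *ᵥ v := by
  have h1 : Q.P (X.D (a + 1) *ᵥ Q.S u) = 0 := by rw [Q.P_mulVec, Q.P_S, h]
  obtain ⟨w, hw⟩ := Q.P_zero h1
  have hwH : HV (t + 1) w := by
    apply Q.HV_of_y
    rw [← hw, add_comm (t + 1)]
    exact HV.mulVec (X.hD a) (Q.S_HV hu)
  have hw0 : X.D a *ᵥ w = 0 := by
    apply Q.y_inj
    rw [smul_zero, ← Matrix.mulVec_smul, ← hw, X.DDv]
  obtain ⟨v', hv', hv'2⟩ := X.lin' a t w hwH hw0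
  have h3 : X.D (a + 1) *ᵥ (Q.S u - Q.y • v') = 0 := by
    rw [Matrix.mulVec_sub, Matrix.mulVec_smul, ← hv'2, hw, sub_self]
  obtain ⟨v, hv⟩ := X.lin (a + 1) t _ ((Q.S_HV hu).sub (by
    rw [add_comm t 1]; exact HV.smul Q.hy hv')) h3
  refine ⟨Q.P v, ?_⟩
  rw [← Q.P_mulVec, ← hv, Q.P_sub, Q.P_S, Q.P_y, sub_zero]

lemma mapDD {e : ℕ} (X : LCx K (r + 1) e) (a : ℕ) :
    (X.D a).map Q.π * (X.D (a + 1)).map Q.π = 0 := by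
  rw [← Matrix.map_mul, X.DD]; simp

/-- truncated quotient -/
def LCx.trunc {e : ℕ} (X : LCx K (r + 1) e) : LCx K r 1 where
  ι a := X.ι (a + 1)
  fin a := X.fin (a + 1)
  D a := (X.D (a + 1)).map Q.π
  hD0 _ _ := Q.hπ _ _ (X.hD _ _ _)
  hD _ _ _ := Q.hπ _ _ (X.hD _ _ _)
  DD _ := mapDD Q X _
  lin a t u hu h := step_lin Q X a t u hu h

/-- good linear form -/
def Good {e : ℕ} (X : LCx K r e) (y : MvPolynomial (Fin r) K) : Prop :=
  ∀ t w, HV (e + t) w → (∃ v, y • w = X.D 0 *ᵥ v) → ∃ v, w = X.D 0 *ᵥ v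

/-- full quotient -/
def LCx.bar {e : ℕ} (X : LCx K (r + 1) e) (hg : Good X Q.y) : LCx K r e where
  ι a := X.ι a
  fin a := X.fin a
  D a := (X.D a).map Q.π
  hD0 _ _ := Q.hπ _ _ (X.hD0 _ _)
  hD _ _ _ := Q.hπ _ _ (X.hD _ _ _)
  DD _ := mapDD Q X _
  lin a t u hu h := by
    cases a with
    | succ a => exact step_lin Q X a t u hu h
    | zero =>
      have h1 : Q.P (X.D 0 *ᵥ Q.S u) = 0 := by rw [Q.P_mulVec, Q.P_S, h]
      obtain ⟨w, hw⟩ := Q.P_zero h1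
      have hwH : HV (e + t) w := by
        apply Q.HV_of_y
        rw [← hw]
        exact HV.mulVec X.hD0 (Q.S_HV hu)
      obtain ⟨v', hv'⟩ := hg t w hwH ⟨_, hw.symm⟩
      obtain ⟨v', hv', hv'2⟩ := X.D0' hwH hv'
      have h3 : X.D 0 *ᵥ (Q.S u - Q.y • v') = 0 := by
        rw [Matrix.mulVec_sub, Matrix.mulVec_smul, ← hv'2, hw, sub_self]
      obtain ⟨v, hv⟩ := X.lin 0 t _ ((Q.S_HV hu).sub (by
        rw [add_comm t 1]; exact HV.smul Q.hy hv')) h3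
      refine ⟨Q.P v, ?_⟩
      rw [← Q.P_mulVec, ← hv, Q.P_sub, Q.P_S, Q.P_y, sub_zero]

end

/-- quotient by a linear form with a nonzero coefficient at q -/
def mkQuo {K : Type} [Field K] {r : ℕ} (c : Fin (r + 1) → K) (q : Fin (r + 1))
    (hq : c q ≠ 0) : Quo K r where
  y := ∑ i, C (c i) * X i
  π := aeval (q.insertNth (α := fun _ => MvPolynomial (Fin r) K)
    (- (C (c q)⁻¹ * ∑ i, C (c (q.succAbove i)) * X i)) X)
  s := rename q.succAbove
  hy := IsHomogeneous.sum _ _ _ fun i _ => isHomogeneous_C_mul_X _ _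
  hy0 := by
    intro h
    have := congrArg (coeff (Finsupp.single q 1)) h
    simp [coeff_sum, coeff_C_mul, coeff_X, Finsupp.single_left_inj] at this
    exact hq this
  hπ t f hf := by
    have := hf.aeval (q.insertNth (α := fun _ => MvPolynomial (Fin r) K)
      (- (C (c q)⁻¹ * ∑ i, C (c (q.succAbove i)) * X i)) X) (n := 1) (by
        intro i
        refine Fin.succAboveCases q ?_ ?_ i
        · rw [Fin.insertNth_apply_same]
          exact ((IsHomogeneous.sum _ _ _ fun i _ => isHomogeneous_C_mul_X _ _).C_mul _).neg
        · intro j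
          rw [Fin.insertNth_apply_succAbove]
          exact isHomogeneous_X _ _)
    rwa [one_mul] at this
  hs t f hf := hf.rename_isHomogeneous
  πs f := by
    have : ((aeval (q.insertNth (α := fun _ => MvPolynomial (Fin r) K)
      (- (C (c q)⁻¹ * ∑ i, C (c (q.succAbove i)) * X i)) X)).comp (rename q.succAbove)) =
      AlgHom.id K (MvPolynomial (Fin r) K) := by
      apply MvPolynomial.algHom_ext
      intro i
      simp
    exact DFunLike.congr_fun this f
  πy := by
    rw [Fin.sum_univ_succAbove _ q]
    simp only [map_add, map_mul, map_sum, aeval_X, Fin.insertNth_apply_same,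
      Fin.insertNth_apply_succAbove, algHom_C, algebraMap_eq]
    rw [mul_neg, ← mul_assoc, ← C_mul, mul_inv_cancel₀ hq, C_1, one_mul, neg_add_cancel]
  hdiv f := by
    set y : MvPolynomial (Fin (r + 1)) K := ∑ i, C (c i) * X i with hy
    set π : MvPolynomial (Fin (r + 1)) K →ₐ[K] _ :=
      aeval (q.insertNth (α := fun _ => MvPolynomial (Fin r) K)
      (- (C (c q)⁻¹ * ∑ i, C (c (q.succAbove i)) * X i)) X) with hπ
    have : (Ideal.Quotient.mkₐ K (Ideal.span {y})).comp ((rename q.succAbove).comp π) =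
        Ideal.Quotient.mkₐ K (Ideal.span {y}) := by
      apply MvPolynomial.algHom_ext
      intro i
      simp only [AlgHom.comp_apply, Ideal.Quotient.mkₐ_eq_mk]
      refine Fin.succAboveCases q ?_ ?_ i
      · rw [eq_comm, Ideal.Quotient.mk_eq_mk_iff_sub_mem, Ideal.mem_span_singleton']
        refine ⟨C (c q)⁻¹, ?_⟩
        rw [hπ, aeval_X, Fin.insertNth_apply_same, hy, Fin.sum_univ_succAbove _ q]
        simp only [map_neg, map_mul, map_sum, rename_C, rename_X]
        rw [mul_add, ← mul_assoc, ← C_mul, inv_mul_cancel₀ hq, C_1]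
        ring
      · intro j
        rw [hπ, aeval_X, Fin.insertNth_apply_succAbove, rename_X]
    have h2 := DFunLike.congr_fun this f
    simp only [AlgHom.comp_apply, Ideal.Quotient.mkₐ_eq_mk] at h2
    rw [eq_comm, Ideal.Quotient.mk_eq_mk_iff_sub_mem, Ideal.mem_span_singleton'] at h2
    obtain ⟨g, hg⟩ := h2
    exact ⟨g, by linear_combination -hg⟩

/-- socle lemma -/
lemma socle {K : Type} [Field K] : ∀ (r e : ℕ) (_ : 1 ≤ e) (Z : LCx K r e) (t : ℕ) (u), HV (e + t) u →
    (∀ l, ∃ v, (X l : MvPolynomial (Fin r) K) • u = Z.D 0 *ᵥ v) → ∃ v, u = Z.D 0 *ᵥ v := by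
  intro r
  induction r with
  | zero =>
    intro e he Z t u hu _
    refine ⟨0, ?_⟩
    rw [Matrix.mulVec_zero]
    funext i
    by_contra hne
    have := (isHomogeneous_of_isEmpty _ _ (u i)).inj_right (hu i) hne
    omega
  | succ r ih =>
    intro e he Z t u hu hl
    let Q : Quo K r := mkQuo (Pi.single 0 1) 0 (by simp)
    have hQy : Q.y = X 0 := by
      change ∑ i, C ((Pi.single 0 1 : Fin (r + 1) → K) i) * X i = X 0
      rw [Finset.sum_eq_single 0] <;> simp +contextual
    have hl' : ∀ l, ∃ v, HV (t + 1) v ∧ (X l : MvPolynomial (Fin (r + 1)) K) • u = Z.D 0 *ᵥ v := by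
      intro l
      obtain ⟨v, hv⟩ := hl l
      refine Z.D0' ?_ hv
      have := HV.smul (isHomogeneous_X K l) hu
      rwa [show e + (t + 1) = 1 + (e + t) by omega]
    choose w hw hwu using hl'
    have hπX : ∀ l : Fin r, Q.π (X l.succ) = X l := by
      intro l
      have : Q.s (X l) = X l.succ := by
        change rename _ (X l) = _
        rw [rename_X]; rfl
      rw [← this, Q.πs]
    obtain ⟨v, hv⟩ := ih 1 le_rfl (Z.trunc Q) t (Q.P (w 0)) (by
      rw [add_comm 1 t]; exact Q.P_HV (hw 0)) (by
      intro l
      have h1 : Z.D 0 *ᵥ ((X l.succ : MvPolynomial (Fin (r + 1)) K) • w 0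
          - (X 0 : MvPolynomial (Fin (r + 1)) K) • w l.succ) = 0 := by
        rw [Matrix.mulVec_sub, Matrix.mulVec_smul, Matrix.mulVec_smul, ← hwu, ← hwu,
          smul_smul, smul_smul, mul_comm, sub_self]
      obtain ⟨v, hv⟩ := Z.lin 0 (t + 1) _ (HV.sub (by
        rw [add_comm (t + 1) 1]; exact HV.smul (isHomogeneous_X _ _) (hw 0)) (by
        rw [add_comm (t + 1) 1]; exact HV.smul (isHomogeneous_X _ _) (hw l.succ))) h1
      refine ⟨Q.P v, ?_⟩
      have h2 := congrArg Q.P hv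
      rw [Q.P_sub, Q.P_smul, hπX, ← hQy, Q.P_y, sub_zero, Q.P_mulVec] at h2
      exact h2)
    change Z.ι 2 → MvPolynomial (Fin r) K at v
    change Q.P (w 0) = (Z.D 1).map Q.π *ᵥ v at hv
    have h3 : Q.P (w 0 - Z.D 1 *ᵥ Q.S v) = 0 := by
      rw [Q.P_sub, Q.P_mulVec, Q.P_S, sub_eq_zero]
      exact hv
    obtain ⟨w', hw'⟩ := Q.P_zero h3
    refine ⟨w', Q.y_inj ?_⟩
    rw [← Matrix.mulVec_smul, ← hw', Matrix.mulVec_sub, Z.DDv, sub_zero, ← hwu, hQy]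

end
end LinRes


namespace LinRes
noncomputable section
open MvPolynomial Matrix

lemma hcv_sum_smul {ι σ K : Type*} [Field K] (g : MvPolynomial σ K) (w : ι → MvPolynomial σ K) :
    ∑ i ∈ Finset.range (g.totalDegree + 1), homogeneousComponent i g • w = g • w := by
  rw [← Finset.sum_smul, sum_homogeneousComponent]

lemma exists_good {K : Type} [Field K] [Infinite K] {r e : ℕ} (he : 1 ≤ e)
    (Z : LCx K (r + 1) e) : ∃ (c : Fin (r + 1) → K) (q : Fin (r + 1)), c q ≠ 0 ∧
      Good Z (∑ i, C (c i) * X i) := by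
  classical
  let R := MvPolynomial (Fin (r + 1)) K
  let N : Submodule R (Z.ι 0 → R) := LinearMap.range (Z.D 0).mulVecLin
  let M := (Z.ι 0 → R) ⧸ N
  have hfin : (associatedPrimes R M).Finite := associatedPrimes.finite R M
  let y : (Fin (r + 1) → K) →ₗ[K] R := ∑ i, (LinearMap.toSpanSingleton K R (X i)) ∘ₗ LinearMap.proj i
  have hy : ∀ c, y c = ∑ i, C (c i) * X i := by
    intro c
    simp only [y, LinearMap.sum_apply, LinearMap.comp_apply, LinearMap.proj_apply, LinearMap.toSpanSingleton_apply]
    exact Finset.sum_congr rfl fun i _ => smul_eq_C_mul _ _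
  let V : Ideal R → Subspace K (Fin (r + 1) → K) := fun P => (P.restrictScalars K).comap y
  let s : Finset (Subspace K (Fin (r + 1) → K)) := insert ⊥ ((hfin.toFinset.image V).filter (· ≠ ⊤))
  have hs : ⊤ ∉ s := by
    simp only [s, Finset.mem_insert, Finset.mem_filter, not_or]
    exact ⟨top_ne_bot, fun h => h.2 rfl⟩
  have := Subspace.biUnion_ne_univ_of_top_notMem hs
  obtain ⟨c, hc⟩ := (Set.ne_univ_iff_exists_notMem _).1 this
  simp only [Set.mem_iUnion, not_exists] at hc
  have hc0 : c ≠ 0 := by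
    intro h
    exact hc ⊥ (by simp [s]) (by simp [h])
  obtain ⟨q, hq⟩ := Function.ne_iff.1 hc0
  refine ⟨c, q, hq, ?_⟩
  rw [← hy]
  intro t w hw ⟨v, hv⟩
  by_contra hcon
  have hwN : w ∉ N := by
    rintro ⟨v, hv⟩
    exact hcon ⟨v, by simpa using hv.symm⟩
  let m : M := N.mkQ w
  have hm : m ≠ 0 := by
    intro h
    exact hwN ((Submodule.Quotient.mk_eq_zero N).1 h)
  let N' : Submodule R M := Submodule.span R {m}
  have : Nontrivial N' := ⟨⟨⟨m, Submodule.mem_span_singleton_self m⟩, 0, by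
    intro h; exact hm (congrArg Subtype.val h)⟩⟩
  obtain ⟨P, hP⟩ := associatedPrimes.nonempty R N'
  have hPM : P ∈ associatedPrimes R M :=
    associatedPrimes.subset_of_injective (f := N'.subtype) N'.injective_subtype hP
  obtain ⟨hPp, x, hx⟩ := isAssociatedPrime_iff.1 hP
  obtain ⟨g, hg⟩ := Submodule.mem_span_singleton.1 x.2
  have hPx : ∀ f : R, f ∈ P ↔ f • (g • w) ∈ N := by
    intro f
    rw [hx, Submodule.mem_colon_singleton, Submodule.mem_bot, ← Subtype.coe_inj, ← (Submodule.Quotient.mk_eq_zero N)]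
    simp only [Submodule.coe_smul, Submodule.coe_zero, ← hg]
    rfl
  have hyP : y c ∈ P := by
    rw [hPx, smul_comm, hv]
    exact N.smul_mem _ ⟨v, by simp⟩
  have hV : V P = ⊤ := by
    by_contra hne
    exact hc (V P) (by
      simp only [s, Finset.mem_insert, Finset.mem_filter, Finset.mem_image]
      right
      exact ⟨⟨P, by simpa using hPM, rfl⟩, hne⟩) hyP
  have hX : ∀ l, (X l : MvPolynomial (Fin (r + 1)) K) • (g • w) ∈ N := by
    intro l
    rw [← hPx]
    have : (Pi.single l 1 : Fin (r + 1) → K) ∈ V P := by rw [hV]; trivial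
    change y (Pi.single l 1) ∈ P at this
    rw [hy, Finset.sum_eq_single l] at this
    · simpa using this
    · intro b _ hb
      simp [hb]
    · simp
  have hgw : g • w ∉ N := by
    intro h
    apply hPp.ne_top
    rw [Ideal.eq_top_iff_one, hPx]
    exact N.smul_mem _ h
  have : ∃ i, homogeneousComponent i g • w ∉ N := by
    by_contra hall
    push Not at hall
    apply hgw
    rw [← hcv_sum_smul]
    exact Submodule.sum_mem _ fun i _ => hall i
  obtain ⟨i, hi⟩ := this
  have hwi : HV (e + (t + i)) (homogeneousComponent i g • w) := by
    have := HV.smul (homogeneousComponent_isHomogeneous i g) hw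
    rwa [show e + (t + i) = i + (e + t) by omega]
  obtain ⟨v', hv'⟩ := socle (r + 1) e he Z (t + i) _ hwi (by
    intro l
    obtain ⟨v, hv⟩ := hX l
    refine ⟨hcv (t + i + 1) v, ?_⟩
    rw [← hcv_mulVec _ Z.hD0]
    rw [Matrix.mulVecLin_apply] at hv
    rw [hv, show e + (t + i + 1) = 1 + (i + (e + t)) by omega, hcv_smul (isHomogeneous_X _ _)]
    congr 1
    funext a
    simp only [hcv, Pi.smul_apply, smul_eq_mul]
    rw [mul_comm g, add_comm i, hc_mul (hw a), mul_comm])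
  exact hi ⟨v', by simpa using hv'.symm⟩

/-- homogeneous vectors as a submodule -/
def HVs (ι σ K : Type) [Field K] (t : ℕ) : Submodule K (ι → MvPolynomial σ K) where
  carrier := {u | HV t u}
  zero_mem' := fun i => isHomogeneous_zero _ _ _
  add_mem' := fun h h' => h.add h'
  smul_mem' := fun a u h i => by
    rw [Pi.smul_apply, smul_eq_C_mul]; exact (h i).C_mul a

lemma HVs_eq (ι σ K : Type) [Field K] (t : ℕ) :
    HVs ι σ K t = Submodule.pi Set.univ (fun _ => homogeneousSubmodule σ K t) := by
  ext u
  simp [HVs, HV, Submodule.mem_pi]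

/-- equivalence -/
def HVs_equiv (ι σ K : Type) [Field K] (t : ℕ) :
    HVs ι σ K t ≃ₗ[K] (ι → homogeneousSubmodule σ K t) where
  toFun u i := ⟨u.1 i, u.2 i⟩
  invFun v := ⟨fun i => (v i).1, fun i => (v i).2⟩
  map_add' _ _ := rfl
  map_smul' _ _ := rfl
  left_inv _ := rfl
  right_inv _ := rfl

instance (σ K : Type) [Field K] [Finite σ] (t : ℕ) :
    Module.Finite K (homogeneousSubmodule σ K t) :=
  Module.Finite.of_fg (homogeneousSubmodule_fg _ _ t)

instance (ι σ K : Type) [Field K] [Finite σ] [Finite ι] (t : ℕ) :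
    Module.Finite K (HVs ι σ K t) := Module.Finite.equiv (HVs_equiv ι σ K t).symm

/-- graded image -/
def G {ι κ σ K : Type} [Field K] [Fintype κ] (M : Matrix ι κ (MvPolynomial σ K)) (j : ℕ) :
    Submodule K (ι → MvPolynomial σ K) :=
  (HVs κ σ K j).map (M.mulVecLin.restrictScalars K)

instance {ι κ σ K : Type} [Field K] [Fintype κ] [Finite σ]
    (M : Matrix ι κ (MvPolynomial σ K)) (j : ℕ) :
    Module.Finite K (G M j) := by unfold G; infer_instance

lemma mem_G {ι κ σ K : Type} [Field K] [Fintype κ] (M : Matrix ι κ (MvPolynomial σ K)) (j : ℕ) (u) :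
    u ∈ G M j ↔ ∃ v, HV j v ∧ u = M *ᵥ v := by
  simp only [G, Submodule.mem_map]
  constructor
  · rintro ⟨v, hv, h⟩; exact ⟨v, hv, h.symm⟩
  · rintro ⟨v, hv, h⟩; exact ⟨v, hv, h.symm⟩

lemma finrank_map_add {K V W : Type*} [Field K] [AddCommGroup V] [Module K V]
    [AddCommGroup W] [Module K W] (f : V →ₗ[K] W) (p : Submodule K V) [Module.Finite K p] :
    Module.finrank K (p.map f) + Module.finrank K (p ⊓ LinearMap.ker f : Submodule K V)
      = Module.finrank K p := by
  have h := LinearMap.finrank_range_add_finrank_ker (f.domRestrict p)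
  rw [LinearMap.range_domRestrict, LinearMap.ker_domRestrict] at h
  rw [← h]
  congr 1
  rw [← Submodule.map_comap_subtype]
  exact (LinearEquiv.finrank_eq (Submodule.equivMapOfInjective p.subtype p.injective_subtype _)).symm

section
variable {K : Type} [Field K] {r : ℕ} (Q : Quo K r)

/-- linear version of P -/
def Quo.Pl (ι : Type) : (ι → MvPolynomial (Fin (r + 1)) K) →ₗ[K] (ι → MvPolynomial (Fin r) K) where
  toFun := Q.P
  map_add' := Q.P_add
  map_smul' a u := by funext i; simp [Quo.P]

lemma map_G {ι κ : Type} [Fintype κ] (M : Matrix ι κ (MvPolynomial (Fin (r + 1)) K)) (j : ℕ) :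
    (G M j).map (Q.Pl ι) = G (M.map Q.π) j := by
  ext u
  rw [mem_G]
  simp only [Submodule.mem_map, mem_G]
  constructor
  · rintro ⟨_, ⟨v, hv, rfl⟩, rfl⟩
    exact ⟨Q.P v, Q.P_HV hv, Q.P_mulVec M v⟩
  · rintro ⟨v, hv, rfl⟩
    refine ⟨_, ⟨Q.S v, Q.S_HV hv, rfl⟩, ?_⟩
    change Q.P _ = _
    rw [Q.P_mulVec, Q.P_S]

lemma ker_G {e : ℕ} (Z : LCx K (r + 1) e) (hg : Good Z Q.y) (j : ℕ) :
    Module.finrank K (G (Z.D 0) (j + 1) ⊓ LinearMap.ker (Q.Pl (Z.ι 0)) : Submodule K _)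
      = Module.finrank K (G (Z.D 0) j) := by
  let m : (Z.ι 0 → MvPolynomial (Fin (r + 1)) K) →ₗ[K] (Z.ι 0 → MvPolynomial (Fin (r + 1)) K) :=
    { toFun := fun u => Q.y • u
      map_add' := fun _ _ => smul_add _ _ _
      map_smul' := fun a u => smul_comm _ _ _ }
  have hm : Function.Injective m := fun u w h => Q.y_inj h
  have : G (Z.D 0) (j + 1) ⊓ LinearMap.ker (Q.Pl (Z.ι 0)) = (G (Z.D 0) j).map m := by
    ext u
    simp only [Submodule.mem_inf, mem_G, Submodule.mem_map, LinearMap.mem_ker]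
    constructor
    · rintro ⟨⟨v, hv, rfl⟩, h⟩
      obtain ⟨w, hw⟩ := Q.P_zero h
      have hwH : HV (e + j) w := by
        apply Q.HV_of_y
        rw [← hw]
        exact HV.mulVec Z.hD0 hv
      obtain ⟨v', hv'⟩ := hg j w hwH ⟨v, hw.symm⟩
      exact ⟨w, Z.D0' hwH hv', hw.symm⟩
    · rintro ⟨_, ⟨v, hv, rfl⟩, rfl⟩
      refine ⟨⟨Q.y • v, ?_, ?_⟩, Q.P_y _⟩
      · rw [add_comm j 1]; exact HV.smul Q.hy hv
      · rw [Matrix.mulVec_smul]; rfl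
  rw [this]
  exact (LinearEquiv.finrank_eq (Submodule.equivMapOfInjective m hm _)).symm

/-- socle in degree e-1 -/
def Soc {e : ℕ} (Z : LCx K r e) (w : Z.ι 0 → MvPolynomial (Fin r) K) : Prop :=
  HV (e - 1) w ∧ ∀ l, ∃ v, (X l : MvPolynomial (Fin r) K) • w = Z.D 0 *ᵥ v

lemma soc_of_y {e : ℕ} (he : 1 ≤ e) (Z : LCx K (r + 1) e) (hg : Good Z Q.y)
    (w : Z.ι 0 → MvPolynomial (Fin (r + 1)) K)
    (hw : HV (e - 1) w) (h : ∃ v, Q.y • w = Z.D 0 *ᵥ v) : Soc Z w := by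
  refine ⟨hw, fun l => ?_⟩
  apply hg 0
  · have := HV.smul (isHomogeneous_X K l) hw
    rwa [show e + 0 = 1 + (e - 1) by omega]
  · obtain ⟨v, hv⟩ := h
    refine ⟨(X l : MvPolynomial (Fin (r + 1)) K) • v, ?_⟩
    rw [Matrix.mulVec_smul, ← hv, smul_comm]

lemma soc_lin {e : ℕ} (Z : LCx K r e) (w : Z.ι 0 → MvPolynomial (Fin r) K)
    (h : Soc Z w) (f : MvPolynomial (Fin r) K) (hf : f.IsHomogeneous 1) :
    ∃ v, f • w = Z.D 0 *ᵥ v := by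
  have : f ∈ Submodule.span K (Set.range (X : Fin r → MvPolynomial (Fin r) K)) := by
    have : f ∈ homogeneousSubmodule (Fin r) K 1 := hf
    rwa [homogeneousSubmodule_one_eq_span_X] at this
  induction this using Submodule.span_induction with
  | mem x hx => obtain ⟨l, rfl⟩ := hx; exact h.2 l
  | zero => exact ⟨0, by simp⟩
  | add x y hx hy h1 h2 =>
    rw [← homogeneousSubmodule_one_eq_span_X] at hx hy
    obtain ⟨v, hv⟩ := h1 hx
    obtain ⟨v', hv'⟩ := h2 hy
    exact ⟨v + v', by rw [add_smul, hv, hv', Matrix.mulVec_add]⟩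
  | smul a x hx h1 =>
    rw [← homogeneousSubmodule_one_eq_span_X] at hx
    obtain ⟨v, hv⟩ := h1 hx
    exact ⟨a • v, by rw [Matrix.mulVec_smul, ← hv, smul_assoc]⟩

lemma soc_pow {e : ℕ} (he : 1 ≤ e) (Z : LCx K (r + 1) e) (hg : Good Z Q.y)
    (x : MvPolynomial (Fin (r + 1)) K) (hx : x.IsHomogeneous 1) :
    ∀ (i : ℕ) (h : Z.ι 0 → MvPolynomial (Fin (r + 1)) K), Soc Z (Q.y ^ i • h) →
      Soc Z (x ^ i • h) := by
  intro i
  induction i with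
  | zero => intro h hh; simpa using hh
  | succ i ih =>
    intro h hh
    rw [pow_succ, mul_smul]
    apply ih
    apply soc_of_y Q he Z hg
    · have h1 := HV.smul hx hh.1
      have : x • Q.y ^ (i + 1) • h = Q.y • (Q.y ^ i • x • h) := by
        simp only [smul_smul]; ring_nf
      rw [this, add_comm 1 (e - 1)] at h1
      exact Q.HV_of_y h1
    · obtain ⟨v, hv⟩ := soc_lin Z _ hh x hx
      refine ⟨v, ?_⟩
      rw [← hv]
      simp only [smul_smul]; ring_nf

lemma exists_pow {ι : Type} : ∀ (t : ℕ) (w : ι → MvPolynomial (Fin (r + 1)) K), HV t w → w ≠ 0 →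
    ∃ (i : ℕ) (h : ι → MvPolynomial (Fin (r + 1)) K), w = Q.y ^ i • h ∧ Q.P h ≠ 0 := by
  intro t
  induction t with
  | zero =>
    intro w hw hw0
    refine ⟨0, w, by simp, ?_⟩
    intro h
    apply hw0
    funext i
    have h1 : Q.π (w i) = 0 := congrFun h i
    have h2 := (totalDegree_zero_iff_isHomogeneous _).2 (hw i)
    rw [totalDegree_eq_zero_iff_eq_C] at h2
    rw [h2] at h1 ⊢
    rw [algHom_C, algebraMap_eq, C_eq_zero] at h1
    rw [h1]; simp
  | succ t ih =>
    intro w hw hw0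
    by_cases h : Q.P w = 0
    · obtain ⟨w', rfl⟩ := Q.P_zero h
      obtain ⟨i, h, h1, h2⟩ := ih w' (Q.HV_of_y hw) (by rintro rfl; simp at hw0)
      exact ⟨i + 1, h, by rw [h1, pow_succ', mul_smul], h2⟩
    · exact ⟨0, w, by simp, h⟩

end

theorem main_T {K : Type} [Field K] [Infinite K] {e : ℕ} (he : 1 ≤ e) :
    ∀ (r : ℕ) (Z : LCx K r e), ∃ μ : ℕ → ℕ,
      (∀ j, Module.finrank K (G (Z.D 0) j) = ∑ m ∈ Finset.range r, μ m * Nat.multichoose (r - m) j) ∧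
      (∀ m, m + 1 < r → μ (m + 1) ≠ 0 → μ m ≠ 0) ∧
      (∀ r', r = r' + 1 → (∃ w, w ≠ 0 ∧ Soc Z w) → μ r' ≠ 0) := by
  intro r
  induction r with
  | zero =>
    intro Z
    refine ⟨0, fun j => ?_, by simp, by simp⟩
    have : G (Z.D 0) j = ⊥ := by
      rw [eq_bot_iff]
      intro u hu
      obtain ⟨v, hv, rfl⟩ := (mem_G _ _ _).1 hu
      have h1 := HV.mulVec Z.hD0 hv
      rw [Submodule.mem_bot]
      funext i
      by_contra hne
      have := (isHomogeneous_of_isEmpty _ _ _).inj_right (h1 i) hne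
      omega
    rw [this]; simp
  | succ r ih =>
    intro Z
    obtain ⟨c, q, hq, hg⟩ := exists_good he Z
    let Q := mkQuo c q hq
    change Good Z Q.y at hg
    obtain ⟨μ, h1, h2, h3⟩ := ih (Z.bar Q hg)
    have hrec : ∀ j, Module.finrank K (G ((Z.bar Q hg).D 0) j) +
        Module.finrank K (G (Z.D 0) j ⊓ LinearMap.ker (Q.Pl (Z.ι 0)) : Submodule K _) =
        Module.finrank K (G (Z.D 0) j) := by
      intro j
      rw [← finrank_map_add (Q.Pl (Z.ι 0)) (G (Z.D 0) j), map_G]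
      rfl
    set κ := Module.finrank K (G (Z.D 0) 0 ⊓ LinearMap.ker (Q.Pl (Z.ι 0)) : Submodule K _) with hκ
    have hfd : Module.Finite K (G (Z.D 0) 0 ⊓ LinearMap.ker (Q.Pl (Z.ι 0)) : Submodule K _) :=
      Submodule.finiteDimensional_of_le inf_le_left
    refine ⟨fun m => if m < r then μ m else κ, ?_, ?_, ?_⟩
    · intro j
      rw [Finset.sum_range_succ]
      dsimp only
      rw [if_neg (lt_irrefl r), Finset.sum_congr rfl (g := fun m => μ m * Nat.multichoose (r + 1 - m) j)
        (fun m hm => by rw [if_pos (Finset.mem_range.1 hm)])]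
      rw [show r + 1 - r = 1 by omega, Nat.multichoose_one, mul_one]
      induction j with
      | zero =>
        rw [← hrec, h1]
        simp only [Nat.multichoose_zero_right]
        rfl
      | succ j ihj =>
        rw [← hrec, ker_G Q Z hg, ihj, h1, ← add_assoc, ← Finset.sum_add_distrib]
        congr 1
        refine Finset.sum_congr rfl fun m hm => ?_
        rw [show r + 1 - m = (r - m) + 1 by have := Finset.mem_range.1 hm; omega,
          Nat.multichoose_succ_succ]
        ring
    · intro m hm
      dsimp only
      rw [if_pos (show m < r by omega)]
      by_cases hm' : m + 1 < r
      · rw [if_pos hm']; exact h2 m hm'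
      · rw [if_neg hm']
        intro hne
        obtain rfl : r = m + 1 := by omega
        apply h3 m rfl
        have : (G (Z.D 0) 0 ⊓ LinearMap.ker (Q.Pl (Z.ι 0)) : Submodule K _) ≠ ⊥ := by
          intro h; apply hne; rw [hκ, h]; simp
        obtain ⟨u, hu, hu0⟩ := Submodule.exists_mem_ne_zero_of_ne_bot this
        obtain ⟨huG, huP⟩ := Submodule.mem_inf.1 hu
        obtain ⟨v, hv, rfl⟩ := (mem_G _ _ _).1 huG
        obtain ⟨w, hw⟩ := Q.P_zero huP
        have hwH : HV (e - 1) w := by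
          apply Q.HV_of_y
          rw [← hw, show e - 1 + 1 = e + 0 by omega]
          exact HV.mulVec Z.hD0 hv
        have hw0 : w ≠ 0 := by rintro rfl; simp at hw; exact hu0 hw
        have hS := soc_of_y Q he Z hg w hwH ⟨v, hw.symm⟩
        obtain ⟨i, h, rfl, hP⟩ := exists_pow Q (e - 1) w hwH hw0
        have hS' := soc_pow Q he Z hg (Q.s (X 0)) (Q.hs _ _ (isHomogeneous_X _ _)) i h hS
        have hne0 : Q.P (Q.s (X 0) ^ i • h) ≠ 0 := by
          rw [Q.P_smul, map_pow, Q.πs]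
          intro h0
          apply hP
          funext a
          have := congrFun h0 a
          simpa using this
        refine ⟨Q.P (Q.s (X 0) ^ i • h), hne0, Q.P_HV hS'.1, ?_⟩
        · intro l
          obtain ⟨v, hv⟩ := soc_lin Z _ hS' (Q.s (X l)) (Q.hs _ _ (isHomogeneous_X _ _))
          refine ⟨Q.P v, ?_⟩
          have := congrArg Q.P hv
          rw [Q.P_smul, Q.πs, Q.P_mulVec] at this
          exact this
    · rintro r' hr' ⟨w, hw0, hw⟩
      obtain rfl : r = r' := by omega
      dsimp only
      rw [if_neg (lt_irrefl _)]
      obtain ⟨v, hv⟩ := soc_lin Z w hw Q.y Q.hy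
      have hH : HV (e + 0) (Q.y • w) := by
        have := HV.smul Q.hy hw.1
        rwa [show e + 0 = 1 + (e - 1) by omega]
      have hmem : Q.y • w ∈ (G (Z.D 0) 0 ⊓ LinearMap.ker (Q.Pl (Z.ι 0)) : Submodule K _) :=
        ⟨(mem_G _ _ _).2 (Z.D0' hH hv), Q.P_y w⟩
      intro h0
      rw [hκ, Submodule.finrank_eq_zero] at h0
      rw [h0, Submodule.mem_bot] at hmem
      apply hw0
      apply Q.y_inj
      rw [hmem, smul_zero]

end
end LinRes


namespace LinRes
noncomputable section
open MvPolynomial Matrix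

lemma finrank_hom (K : Type) [Field K] (n j : ℕ) :
    Module.finrank K (homogeneousSubmodule (Fin n) K j) = Nat.multichoose n j := by
  classical
  rw [homogeneousSubmodule_eq_finsupp_supported]
  rw [LinearEquiv.finrank_eq (AddMonoidAlgebra.supportedEquivFinsupp _)]
  have e : {d : Fin n →₀ ℕ | Finsupp.degree d = j} ≃ Finset.finsuppAntidiag (Finset.univ : Finset (Fin n)) j :=
    Equiv.subtypeEquivRight (fun d => by
      simp [Finset.mem_finsuppAntidiag, Finsupp.degree_eq_sum])
  have : Fintype {d : Fin n →₀ ℕ | Finsupp.degree d = j} := Fintype.ofEquiv _ e.symm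
  rw [Module.finrank_finsupp_self, Fintype.card_congr e, Fintype.card_coe,
    Finset.card_finsuppAntidiag_nat_eq_multichoose]
  simp

lemma finrank_HVs (K : Type) [Field K] (ι : Type) [Fintype ι] (n j : ℕ) :
    Module.finrank K (HVs ι (Fin n) K j) = Fintype.card ι * Nat.multichoose n j := by
  rw [LinearEquiv.finrank_eq (HVs_equiv ι (Fin n) K j), Module.finrank_pi_fintype]
  simp [finrank_hom]

/-- exact on constants -/
def LCx.Inj0 {K : Type} [Field K] {r e : ℕ} (Z : LCx K r e) : Prop :=
  ∀ a u, HV 0 u → Z.D a *ᵥ u = 0 → u = 0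

section
variable {K : Type} [Field K] {n e : ℕ} (Z : LCx K n e)

lemma G_zero (hZ : Z.Inj0) (a : ℕ) :
    Module.finrank K (G (Z.D a) 0) = Fintype.card (Z.ι (a + 1)) := by
  have h := finrank_map_add ((Z.D a).mulVecLin.restrictScalars K) (HVs (Z.ι (a + 1)) (Fin n) K 0)
  rw [finrank_HVs, Nat.multichoose_zero_right, mul_one] at h
  rw [← h]
  have : HVs (Z.ι (a + 1)) (Fin n) K 0 ⊓ LinearMap.ker ((Z.D a).mulVecLin.restrictScalars K) = ⊥ := by
    rw [eq_bot_iff]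
    rintro u ⟨h1, h2⟩
    exact hZ a u h1 h2
  rw [this, finrank_bot]
  rfl

lemma G_succ (a j : ℕ) :
    Module.finrank K (G (Z.D a) (j + 1)) + Module.finrank K (G (Z.D (a + 1)) j)
      = Fintype.card (Z.ι (a + 1)) * Nat.multichoose n (j + 1) := by
  have h := finrank_map_add ((Z.D a).mulVecLin.restrictScalars K) (HVs (Z.ι (a + 1)) (Fin n) K (j + 1))
  rw [finrank_HVs] at h
  rw [← h]
  have : HVs (Z.ι (a + 1)) (Fin n) K (j + 1) ⊓ LinearMap.ker ((Z.D a).mulVecLin.restrictScalars K)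
      = G (Z.D (a + 1)) j := by
    ext u
    rw [mem_G]
    constructor
    · rintro ⟨h1, h2⟩
      exact Z.lin' a j u h1 h2
    · rintro ⟨v, hv, rfl⟩
      refine ⟨?_, Z.DDv a v⟩
      have := HV.mulVec (Z.hD a) hv
      rwa [add_comm 1 j] at this
  rw [this]
  rfl

/-- Hilbert series of a polynomial ring -/
def Hs (r : ℕ) : PowerSeries ℤ := PowerSeries.mk fun j => (Nat.multichoose r j : ℤ)

lemma Hs_succ (r : ℕ) : (1 - PowerSeries.X) * Hs (r + 1) = Hs r := by
  ext j
  cases j with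
  | zero => simp [Hs, sub_mul]
  | succ j =>
    simp [Hs, sub_mul, PowerSeries.coeff_succ_X_mul, Nat.multichoose_succ_succ]

lemma Hs_zero : Hs 0 = 1 := by
  ext j
  cases j with
  | zero => simp [Hs]
  | succ j => simp [Hs, PowerSeries.coeff_one]

lemma Hs_pow (m r : ℕ) : (1 - PowerSeries.X) ^ m * Hs (r + m) = Hs r := by
  induction m with
  | zero => simp
  | succ m ih => rw [pow_succ, mul_assoc, ← add_assoc, Hs_succ, ih]

lemma Hs_inv (r : ℕ) : (1 - PowerSeries.X) ^ r * Hs r = 1 := by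
  have := Hs_pow r 0
  rwa [zero_add, Hs_zero] at this

lemma coeff_one_sub (m a : ℕ) : PowerSeries.coeff a ((1 - PowerSeries.X : PowerSeries ℤ) ^ m)
    = (-1) ^ a * (Nat.choose m a : ℤ) := by
  induction m generalizing a with
  | zero => cases a <;> simp [PowerSeries.coeff_one]
  | succ m ih =>
    rw [pow_succ', sub_mul, one_mul, map_sub]
    cases a with
    | zero => simp [ih]
    | succ a =>
      rw [PowerSeries.coeff_succ_X_mul, ih, ih, Nat.choose_succ_succ]
      push_cast
      ring

/-- Hilbert series of G -/
def As (a : ℕ) : PowerSeries ℤ := PowerSeries.mk fun j => (Module.finrank K (G (Z.D a) j) : ℤ)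

lemma As_rec (hZ : Z.Inj0) (a : ℕ) :
    As Z a + PowerSeries.X * As Z (a + 1) = PowerSeries.C (Fintype.card (Z.ι (a + 1)) : ℤ) * Hs n := by
  ext j
  cases j with
  | zero => simp [As, Hs, G_zero Z hZ]
  | succ j =>
    rw [map_add, PowerSeries.coeff_succ_X_mul, PowerSeries.coeff_C_mul]
    simp only [As, Hs, PowerSeries.coeff_mk]
    exact_mod_cast G_succ Z a j

lemma As_coeff (hZ : Z.Inj0) (s a : ℕ) :
    PowerSeries.coeff s ((1 - PowerSeries.X) ^ n * As Z a)
      = (-1) ^ s * (Fintype.card (Z.ι (a + s + 1)) : ℤ) := by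
  induction s generalizing a with
  | zero =>
    have h := congrArg (fun f => PowerSeries.coeff 0 ((1 - PowerSeries.X) ^ n * f)) (As_rec Z hZ a)
    rw [mul_left_comm, Hs_inv, mul_add, mul_left_comm] at h
    simpa using h
  | succ s ih =>
    have h := congrArg (fun f => PowerSeries.coeff (s + 1) ((1 - PowerSeries.X) ^ n * f)) (As_rec Z hZ a)
    rw [mul_left_comm, Hs_inv, mul_add, mul_left_comm, map_add, PowerSeries.coeff_succ_X_mul, ih, mul_one,
      PowerSeries.coeff_C, if_neg (by omega)] at h
    rw [show a + (s + 1) + 1 = a + 1 + s + 1 by omega, pow_succ]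
    linarith

lemma betti_eq (hZ : Z.Inj0) (μ : ℕ → ℕ)
    (h : ∀ j, Module.finrank K (G (Z.D 0) j) = ∑ m ∈ Finset.range n, μ m * Nat.multichoose (n - m) j)
    (a : ℕ) : Fintype.card (Z.ι (a + 1)) = ∑ m ∈ Finset.range n, μ m * Nat.choose m a := by
  have h1 : As Z 0 = ∑ m ∈ Finset.range n, PowerSeries.C (μ m : ℤ) * Hs (n - m) := by
    ext j
    simp only [As, Hs, PowerSeries.coeff_mk, map_sum, PowerSeries.coeff_C_mul, h]
    push_cast
    rfl
  have h2 : (1 - PowerSeries.X) ^ n * As Z 0 = ∑ m ∈ Finset.range n, PowerSeries.C (μ m : ℤ) * (1 - PowerSeries.X) ^ m := by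
    rw [h1, Finset.mul_sum]
    refine Finset.sum_congr rfl fun m hm => ?_
    rw [mul_left_comm]
    congr 1
    have hmn : m + (n - m) = n := by have := Finset.mem_range.1 hm; omega
    conv_lhs => rw [← hmn]
    rw [pow_add, mul_assoc, show m + (n - m) - m = n - m by omega, Hs_inv, mul_one]
  have h3 := As_coeff Z hZ a 0
  rw [h2, map_sum] at h3
  simp only [PowerSeries.coeff_C_mul, coeff_one_sub, zero_add] at h3
  have h4 : ((-1 : ℤ)) ^ a * (∑ m ∈ Finset.range n, (μ m : ℤ) * (Nat.choose m a : ℤ)) =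
      (-1) ^ a * (Fintype.card (Z.ι (a + 1)) : ℤ) := by
    rw [← h3, Finset.mul_sum]
    exact Finset.sum_congr rfl fun m _ => by ring
  have h5 := mul_left_cancel₀ (pow_ne_zero a (by norm_num : (-1 : ℤ) ≠ 0)) h4
  exact_mod_cast h5.symm

end

lemma finrank_G_eq {K L : Type} [Field K] [Field L] {n e : ℕ} (Z : LCx K n e) (Y : LCx L n e)
    (hZ : Z.Inj0) (hY : Y.Inj0) (h : ∀ a, Fintype.card (Z.ι a) = Fintype.card (Y.ι a)) (j : ℕ) :
    Module.finrank K (G (Z.D 0) j) = Module.finrank L (G (Y.D 0) j) := by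
  have h1 : (1 - PowerSeries.X) ^ n * As Z 0 = (1 - PowerSeries.X) ^ n * As Y 0 := by
    ext s
    rw [As_coeff Z hZ, As_coeff Y hY, h]
  have h2 : As Z 0 = As Y 0 := by
    have := congrArg (Hs n * ·) h1
    simp only [← mul_assoc] at this
    rwa [mul_comm (Hs n), Hs_inv, one_mul, one_mul] at this
  have := congrArg (PowerSeries.coeff j) h2
  simpa [As] using this

end
end LinRes


namespace LinRes
noncomputable section
open MvPolynomial Matrix

section
variable {k L : Type} [Field k] [Field L] [Algebra k L] {σ I : Type} (B : Module.Basis I k L)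

/-- coordinate of a polynomial -/
def cs (s : I) (g : MvPolynomial σ L) : MvPolynomial σ k :=
  ∑ m ∈ g.support, monomial m (B.repr (coeff m g) s)

lemma coeff_cs (s : I) (g : MvPolynomial σ L) (m : σ →₀ ℕ) :
    coeff m (cs B s g) = B.repr (coeff m g) s := by
  classical
  simp only [cs, coeff_sum, coeff_monomial]
  rw [Finset.sum_ite_eq']
  split_ifs with h
  · rfl
  · rw [notMem_support_iff.1 h]; simp

lemma cs_zero (s : I) : cs B s (0 : MvPolynomial σ L) = 0 := by
  ext m; simp [coeff_cs]

lemma cs_sum (s : I) {κ : Type} (T : Finset κ) (f : κ → MvPolynomial σ L) :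
    cs B s (∑ i ∈ T, f i) = ∑ i ∈ T, cs B s (f i) := by
  ext m; simp [coeff_cs, coeff_sum]

lemma cs_mul (s : I) (f : MvPolynomial σ k) (g : MvPolynomial σ L) :
    cs B s (MvPolynomial.map (algebraMap k L) f * g) = f * cs B s g := by
  classical
  ext m
  simp only [coeff_cs, coeff_mul, coeff_map, map_sum, Finsupp.finsetSum_apply, ← Algebra.smul_def,
    map_smul, Finsupp.smul_apply, smul_eq_mul]

lemma cs_hom (s : I) {t : ℕ} {g : MvPolynomial σ L} (h : g.IsHomogeneous t) :
    (cs B s g).IsHomogeneous t := by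
  intro m hm
  apply h
  rw [coeff_cs] at hm
  intro h0
  rw [h0] at hm
  simp at hm

lemma cs_mulVec (s : I) {ι κ : Type} [Fintype κ] (M : Matrix ι κ (MvPolynomial σ k))
    (u : κ → MvPolynomial σ L) :
    (fun i => cs B s ((M.map (MvPolynomial.map (algebraMap k L)) *ᵥ u) i)) = M *ᵥ fun i => cs B s (u i) := by
  funext i
  simp only [Matrix.mulVec, dotProduct, cs_sum, Matrix.map_apply, cs_mul]

lemma cs_decomp {κ : Type} [Finite κ] (u : κ → MvPolynomial σ L) :
    ∃ T : Finset I, u = ∑ s ∈ T, (C (B s) : MvPolynomial σ L) •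
      fun i => MvPolynomial.map (algebraMap k L) (cs B s (u i)) := by
  classical
  have := Fintype.ofFinite κ
  refine ⟨Finset.univ.biUnion fun i => (u i).support.biUnion fun m => (B.repr (coeff m (u i))).support, ?_⟩
  set T := Finset.univ.biUnion fun i => (u i).support.biUnion fun m => (B.repr (coeff m (u i))).support with hT
  funext i
  ext m
  simp only [Finset.sum_apply, Pi.smul_apply, smul_eq_mul, coeff_sum, coeff_C_mul, coeff_map, coeff_cs]
  conv_lhs => rw [← B.linearCombination_repr (coeff m (u i)), Finsupp.linearCombination_apply]
  rw [Finsupp.sum_of_support_subset (s := T)]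
  · exact Finset.sum_congr rfl fun s _ => by rw [Algebra.smul_def, mul_comm]
  · intro s hs
    by_cases hm : m ∈ (u i).support
    · simp only [hT, Finset.mem_biUnion]
      exact ⟨i, Finset.mem_univ _, m, hm, hs⟩
    · rw [notMem_support_iff.1 hm] at hs
      simp at hs
  · simp

end

lemma map_mulVec' {k L : Type} [Field k] [Field L] [Algebra k L] {σ ι κ : Type} [Fintype κ]
    (M : Matrix ι κ (MvPolynomial σ k)) (v : κ → MvPolynomial σ k) :
    (fun i => MvPolynomial.map (algebraMap k L) ((M *ᵥ v) i)) =
      M.map (MvPolynomial.map (algebraMap k L)) *ᵥ fun i => MvPolynomial.map (algebraMap k L) (v i) := by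
  funext i
  simp [Matrix.mulVec, dotProduct]

/-- base change -/
def LCx.base {k : Type} [Field k] {r e : ℕ} (Z : LCx k r e) (L : Type) [Field L] [Algebra k L] :
    LCx L r e where
  ι := Z.ι
  fin := Z.fin
  D a := (Z.D a).map (MvPolynomial.map (algebraMap k L))
  hD0 i j := (Z.hD0 i j).map _
  hD a i j := (Z.hD a i j).map _
  DD a := by rw [← Matrix.map_mul, Z.DD]; simp
  lin a t u hu h := by
    let B := Module.Basis.ofVectorSpace k L
    obtain ⟨T, hT⟩ := cs_decomp B u
    have : ∀ s, ∃ v, (fun i => cs B s (u i)) = Z.D (a + 1) *ᵥ v := by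
      intro s
      apply Z.lin a t
      · exact fun i => cs_hom B s (hu i)
      · rw [← cs_mulVec, h]
        funext i; exact cs_zero B s
    choose v hv using this
    refine ⟨∑ s ∈ T, (C (B s) : MvPolynomial (Fin r) L) • fun i => MvPolynomial.map (algebraMap k L) (v s i), ?_⟩
    rw [hT]
    simp only [Matrix.mulVec_sum, Matrix.mulVec_smul]
    refine Finset.sum_congr rfl fun s _ => ?_
    rw [← map_mulVec', ← hv]

lemma LCx.base_inj0 {k : Type} [Field k] {r e : ℕ} (Z : LCx k r e) (hZ : Z.Inj0) (L : Type)
    [Field L] [Algebra k L] : (Z.base L).Inj0 := by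
  intro a u hu h
  change (Z.D a).map (MvPolynomial.map (algebraMap k L)) *ᵥ u = 0 at h
  change Z.ι (a + 1) → MvPolynomial (Fin r) L at u
  let B := Module.Basis.ofVectorSpace k L
  obtain ⟨T, hT⟩ := cs_decomp B u
  rw [hT]
  refine Finset.sum_eq_zero fun s _ => ?_
  have h0 : (fun i => cs B s (u i)) = 0 := by
    apply hZ a
    · exact fun i => cs_hom B s (hu i)
    · rw [← cs_mulVec, h]
      funext i; exact cs_zero B s
  have h1 : ∀ i, cs B s (u i) = 0 := fun i => congrFun h0 i
  funext i
  simp [h1]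
  rfl

/-- structure theorem over any field -/
theorem main_any {k : Type} [Field k] {n e : ℕ} (he : 1 ≤ e) (Z : LCx k n e) (hZ : Z.Inj0) :
    ∃ μ : ℕ → ℕ,
      (∀ j, Module.finrank k (G (Z.D 0) j) = ∑ m ∈ Finset.range n, μ m * Nat.multichoose (n - m) j) ∧
      (∀ m, m + 1 < n → μ (m + 1) ≠ 0 → μ m ≠ 0) ∧
      (∀ a, Fintype.card (Z.ι (a + 1)) = ∑ m ∈ Finset.range n, μ m * Nat.choose m a) := by
  have : Infinite (AlgebraicClosure k) := inferInstance
  obtain ⟨μ, h1, h2, -⟩ := main_T he n (Z.base (AlgebraicClosure k))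
  have h3 : ∀ j, Module.finrank k (G (Z.D 0) j) = ∑ m ∈ Finset.range n, μ m * Nat.multichoose (n - m) j := by
    intro j
    rw [← h1]
    exact finrank_G_eq Z _ hZ (Z.base_inj0 hZ _) (fun _ => rfl) j
  exact ⟨μ, h3, h2, fun a => betti_eq Z hZ μ h3 a⟩

end
end LinRes


namespace LinRes
noncomputable section
open MvPolynomial Matrix

lemma dim_bound {k : Type} [Field k] {n c s : ℕ} (I : Ideal (MvPolynomial (Fin n) k))
    (hht : ∀ P : PrimeSpectrum (MvPolynomial (Fin n) k), I ≤ P.asIdeal → (c : ℕ∞) ≤ Order.height P)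
    (g : MvPolynomial (Fin s) k →ₐ[k] (MvPolynomial (Fin n) k ⧸ I))
    (hinj : Function.Injective g) (hint : g.toRingHom.IsIntegral) : c + s ≤ n := by
  let _ : Algebra (MvPolynomial (Fin s) k) (MvPolynomial (Fin n) k ⧸ I) := g.toRingHom.toAlgebra
  have : Algebra.IsIntegral (MvPolynomial (Fin s) k) (MvPolynomial (Fin n) k ⧸ I) := ⟨hint⟩
  have hdim : ∀ r : ℕ, ringKrullDim (MvPolynomial (Fin r) k) = (r : WithBot ℕ∞) := by
    intro r
    rw [MvPolynomial.ringKrullDim_of_isNoetherianRing]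
    simp
  obtain ⟨l, hl⟩ := Order.le_krullDim_iff.1 (hdim s).ge
  have key : ∀ t (ht : t < l.length + 1), ∃ (Q : Ideal (MvPolynomial (Fin n) k ⧸ I)) (hQ : Q.IsPrime),
      Q.comap (algebraMap (MvPolynomial (Fin s) k) _) = (l ⟨t, ht⟩).asIdeal ∧
      ((c + t : ℕ) : ℕ∞) ≤ Order.height (PrimeSpectrum.comap (Ideal.Quotient.mk I) ⟨Q, hQ⟩) := by
    intro t
    induction t with
    | zero =>
      intro ht
      obtain ⟨Q, -, hQ, h⟩ := Ideal.exists_ideal_over_prime_of_isIntegral (l ⟨0, ht⟩).asIdeal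
        (⊥ : Ideal (MvPolynomial (Fin n) k ⧸ I)) (by
          intro x hx
          have : g x = 0 := hx
          rw [(map_eq_zero_iff g hinj).1 this]
          exact Ideal.zero_mem _)
      refine ⟨Q, hQ, h, hht _ ?_⟩
      intro x hx
      change Ideal.Quotient.mk I x ∈ Q
      rw [Ideal.Quotient.eq_zero_iff_mem.2 hx]
      exact Q.zero_mem
    | succ t ih =>
      intro ht
      obtain ⟨Q, hQ, h, hh⟩ := ih (by omega)
      have hlt : l ⟨t, by omega⟩ < l ⟨t + 1, ht⟩ := l.strictMono (by simp)
      obtain ⟨Q', hle, hQ', h'⟩ := Ideal.exists_ideal_over_prime_of_isIntegral_of_isPrime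
        (l ⟨t + 1, ht⟩).asIdeal Q (by rw [h]; exact hlt.le)
      refine ⟨Q', hQ', h', ?_⟩
      have : PrimeSpectrum.comap (Ideal.Quotient.mk I) ⟨Q, hQ⟩ < PrimeSpectrum.comap (Ideal.Quotient.mk I) ⟨Q', hQ'⟩ := by
        rw [lt_iff_le_not_ge]
        refine ⟨fun x hx => hle hx, fun hge => ?_⟩
        have : Q' ≤ Q := by
          intro y hy
          obtain ⟨x, rfl⟩ := Ideal.Quotient.mk_surjective y
          exact hge hy
        have heq : Q = Q' := le_antisymm hle this
        subst heq
        rw [h] at h'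
        exact hlt.ne (PrimeSpectrum.ext h')
      refine le_trans ?_ (Order.height_add_one_le this)
      rw [← add_assoc, Nat.cast_add _ 1]
      gcongr
      simp
  obtain ⟨Q, hQ, -, h⟩ := key l.length (by omega)
  have h2 := Order.height_le_krullDim (PrimeSpectrum.comap (Ideal.Quotient.mk I) ⟨Q, hQ⟩)
  have h3 : Order.krullDim (PrimeSpectrum (MvPolynomial (Fin n) k)) = (n : WithBot ℕ∞) := hdim n
  rw [h3] at h2
  have h4 : (((c + l.length : ℕ) : ℕ∞) : WithBot ℕ∞) ≤ ((n : ℕ∞) : WithBot ℕ∞) :=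
    le_trans (WithBot.coe_le_coe.2 h) h2
  rw [WithBot.coe_le_coe, Nat.cast_le, hl] at h4
  exact h4

lemma finrank_rd {k : Type} [Field k] (s D : ℕ) :
    Module.Finite k (restrictDegree (Fin s) k D) ∧
    Module.finrank k (restrictDegree (Fin s) k D) ≤ (D + 1) ^ s := by
  have hinj : Function.Injective (fun m : {m : Fin s →₀ ℕ | ∀ i, m i ≤ D} =>
    fun i : Fin s => (⟨m.1 i, Nat.lt_succ_of_le (m.2 i)⟩ : Fin (D + 1))) := by
    intro m m' h
    ext i
    simpa using congrFun h i
  have := Finite.of_injective _ hinj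
  have := Fintype.ofFinite {m : Fin s →₀ ℕ | ∀ i, m i ≤ D}
  let b : Module.Basis {m : Fin s →₀ ℕ | ∀ i, m i ≤ D} k (restrictDegree (Fin s) k D) := basisRestrictSupport k _
  refine ⟨Module.Finite.of_basis b, ?_⟩
  rw [Module.finrank_eq_card_basis b]
  refine (Fintype.card_le_of_injective _ hinj).trans ?_
  simp

lemma rd_mul {k : Type} [Field k] {s a b : ℕ} {p q : MvPolynomial (Fin s) k}
    (hp : p ∈ restrictDegree (Fin s) k a) (hq : q ∈ restrictDegree (Fin s) k b) :
    p * q ∈ restrictDegree (Fin s) k (a + b) := by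
  classical
  rw [mem_restrictDegree] at *
  intro m hm i
  obtain ⟨x, hx, y, hy, rfl⟩ := Finset.mem_add.1 (support_mul p q hm)
  exact add_le_add (hp x hx i) (hq y hy i)

lemma rd_mono {k : Type} [Field k] {s a b : ℕ} (h : a ≤ b) {p : MvPolynomial (Fin s) k}
    (hp : p ∈ restrictDegree (Fin s) k a) : p ∈ restrictDegree (Fin s) k b := by
  rw [mem_restrictDegree] at *
  exact fun m hm i => (hp m hm i).trans h

lemma rd_total {k : Type} [Field k] {s : ℕ} (p : MvPolynomial (Fin s) k) :
    p ∈ restrictDegree (Fin s) k p.totalDegree := by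
  rw [mem_restrictDegree]
  intro m hm i
  exact (Finsupp.le_degree i m).trans (le_totalDegree hm)

lemma finite_growth {k A : Type} [Field k] [CommRing A] [Algebra k A] {n s : ℕ} (x : Fin n → A)
    (g : MvPolynomial (Fin s) k →ₐ[k] A) (hfin : g.toRingHom.Finite) :
    ∃ B : ℕ, ∀ J : ℕ, ∃ U : Submodule k A, Module.Finite k U ∧
      Module.finrank k U ≤ B * (J + 1) ^ s ∧
      ∀ f : MvPolynomial (Fin n) k, f.totalDegree ≤ J → aeval x f ∈ U := by
  let _ : Algebra (MvPolynomial (Fin s) k) A := g.toRingHom.toAlgebra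
  have : Module.Finite (MvPolynomial (Fin s) k) A := hfin
  obtain ⟨N, m, hm⟩ := Module.Finite.exists_fin (R := MvPolynomial (Fin s) k) (M := A)
  have hrep : ∀ z : A, ∃ q : Fin N → MvPolynomial (Fin s) k, ∑ b, g (q b) * m b = z := by
    intro z
    have : z ∈ Submodule.span (MvPolynomial (Fin s) k) (Set.range m) := by rw [hm]; trivial
    obtain ⟨q, hq⟩ := (Submodule.mem_span_range_iff_exists_fun _).1 this
    exact ⟨q, hq⟩
  choose q hq using hrep
  let E := (∑ b, (q 1 b).totalDegree) + ∑ i, ∑ b, ∑ b', (q (x i * m b) b').totalDegree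
  have hE1 : ∀ b, q 1 b ∈ restrictDegree (Fin s) k E := by
    intro b
    refine rd_mono ?_ (rd_total _)
    exact (Finset.single_le_sum (f := fun b => (q 1 b).totalDegree) (fun _ _ => Nat.zero_le _) (Finset.mem_univ b)).trans (Nat.le_add_right _ _)
  have hE2 : ∀ i b b', q (x i * m b) b' ∈ restrictDegree (Fin s) k E := by
    intro i b b'
    refine rd_mono ?_ (rd_total _)
    refine le_trans ?_ (Nat.le_add_left _ _)
    refine le_trans ?_ (Finset.single_le_sum (f := fun i => ∑ b, ∑ b', (q (x i * m b) b').totalDegree) (fun _ _ => Nat.zero_le _) (Finset.mem_univ i))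
    refine le_trans ?_ (Finset.single_le_sum (f := fun b => ∑ b', (q (x i * m b) b').totalDegree) (fun _ _ => Nat.zero_le _) (Finset.mem_univ b))
    exact Finset.single_le_sum (f := fun b' => (q (x i * m b) b').totalDegree) (fun _ _ => Nat.zero_le _) (Finset.mem_univ b')
  let F : ∀ D, (Fin N → restrictDegree (Fin s) k D) →ₗ[k] A := fun D =>
    ∑ b, (LinearMap.mulRight k (m b)) ∘ₗ g.toLinearMap ∘ₗ (restrictDegree (Fin s) k D).subtype ∘ₗ LinearMap.proj b
  have hF : ∀ D v, F D v = ∑ b, g (v b) * m b := by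
    intro D v
    simp [F]
  have hfd : ∀ D, Module.Finite k (restrictDegree (Fin s) k D) := fun D => (finrank_rd s D).1
  let U : ℕ → Submodule k A := fun D => LinearMap.range (F D)
  have hUmem : ∀ D (p : Fin N → MvPolynomial (Fin s) k), (∀ b, p b ∈ restrictDegree (Fin s) k D) →
      ∑ b, g (p b) * m b ∈ U D := by
    intro D p hp
    exact ⟨fun b => ⟨p b, hp b⟩, hF D _⟩
  have hUm : ∀ D, ∀ u ∈ U D, ∀ i, x i * u ∈ U (D + E) := by
    rintro D _ ⟨v, rfl⟩ i
    rw [hF, Finset.mul_sum]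
    refine Submodule.sum_mem _ fun b _ => ?_
    have : x i * (g (v b) * m b) = ∑ b', g (v b * q (x i * m b) b') * m b' := by
      rw [mul_left_comm, ← hq (x i * m b), Finset.mul_sum]
      refine Finset.sum_congr rfl fun b' _ => ?_
      rw [hq, map_mul, mul_assoc]
    rw [this]
    exact hUmem _ _ fun b' => rd_mul (v b).2 (hE2 i b b')
  have hUmono : ∀ a b, a ≤ b → U a ≤ U b := by
    rintro a b hab _ ⟨v, rfl⟩
    rw [hF]
    exact hUmem _ _ fun b' => rd_mono hab (v b').2
  have hU1 : (1 : A) ∈ U E := by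
    rw [← hq 1]; exact hUmem _ _ hE1
  have hmon : ∀ (J : ℕ) (e : Fin n →₀ ℕ), e.degree = J → aeval x (monomial e (1 : k)) ∈ U ((J + 1) * E) := by
    intro J
    induction J with
    | zero =>
      intro e he
      rw [Finsupp.degree_eq_zero_iff] at he
      subst he
      simpa using hU1
    | succ J ih =>
      intro e he
      have : e ≠ 0 := by rintro rfl; simp at he
      obtain ⟨i, hi⟩ := Finsupp.ne_iff.1 this
      have hle : Finsupp.single i 1 ≤ e := by
        rw [Finsupp.single_le_iff]; exact Nat.one_le_iff_ne_zero.2 hi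
      have he2 : e = Finsupp.single i 1 + (e - Finsupp.single i 1) := (add_tsub_cancel_of_le hle).symm
      have hd : (e - Finsupp.single i 1).degree = J := by
        have := congrArg Finsupp.degree he2
        rw [map_add, Finsupp.degree_single, he] at this
        omega
      have := hUm _ _ (ih _ hd) i
      rw [show (J + 1 + 1) * E = (J + 1) * E + E by ring]
      convert this using 1
      conv_lhs => rw [he2, ← one_mul (1 : k), ← monomial_mul, map_mul]
      congr 1
      exact aeval_X x i
  refine ⟨N * (E + 1) ^ s, fun J => ⟨U ((J + 1) * E), inferInstance, ?_, ?_⟩⟩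
  · refine (LinearMap.finrank_range_le _).trans ?_
    rw [Module.finrank_pi_fintype]
    simp only [Finset.sum_const, Finset.card_univ, Fintype.card_fin, smul_eq_mul]
    rw [mul_assoc, ← mul_pow]
    refine Nat.mul_le_mul_left _ ((finrank_rd s _).2.trans (Nat.pow_le_pow_left ?_ _))
    nlinarith
  · intro f hf
    rw [f.as_sum, map_sum]
    refine Submodule.sum_mem _ fun e he => ?_
    have h1 : monomial e (coeff e f) = (coeff e f) • monomial e (1 : k) := by simp [smul_monomial]
    rw [h1, map_smul]
    apply Submodule.smul_mem
    refine hUmono _ _ ?_ (hmon e.degree e rfl)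
    refine Nat.mul_le_mul_right _ (Nat.succ_le_succ ?_)
    exact (le_totalDegree he).trans hf

/-- graded piece of an ideal -/
def Ig {k : Type} [Field k] {n : ℕ} (I : Ideal (MvPolynomial (Fin n) k)) (j : ℕ) :
    Submodule k (MvPolynomial (Fin n) k) := homogeneousSubmodule (Fin n) k j ⊓ I.restrictScalars k

theorem growth {k : Type} [Field k] {n c : ℕ} (I : Ideal (MvPolynomial (Fin n) k)) (hI : I ≠ ⊤)
    (hom : ∀ f ∈ I, ∀ j, homogeneousComponent j f ∈ I)
    (hht : ∀ P : PrimeSpectrum (MvPolynomial (Fin n) k), I ≤ P.asIdeal → (c : ℕ∞) ≤ Order.height P) :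
    ∃ s, c + s ≤ n ∧ ∃ (h : ℕ → ℕ) (B : ℕ), (∀ j, h j + Module.finrank k (Ig I j) = Nat.multichoose n j) ∧
      ∀ J, ∑ j ∈ Finset.range (J + 1), h j ≤ B * (J + 1) ^ s := by
  have : Nontrivial (MvPolynomial (Fin n) k ⧸ I) := Ideal.Quotient.nontrivial_iff.2 hI
  obtain ⟨s, g, hinj, hfin⟩ := exists_finite_inj_algHom_of_fg k (MvPolynomial (Fin n) k ⧸ I)
  refine ⟨s, dim_bound I hht g hinj hfin.to_isIntegral, ?_⟩
  obtain ⟨B, hB⟩ := finite_growth (fun i => Ideal.Quotient.mk I (X i)) g hfin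
  have haev : ∀ f, aeval (fun i => Ideal.Quotient.mk I (X i)) f = Ideal.Quotient.mk I f := by
    intro f
    have : aeval (fun i => Ideal.Quotient.mk I (X i)) = Ideal.Quotient.mkₐ k I := by
      apply MvPolynomial.algHom_ext; intro i; simp
    rw [this]; rfl
  have hcomp : ∀ j, ∃ C : Submodule k (MvPolynomial (Fin n) k), C ≤ homogeneousSubmodule (Fin n) k j ∧
      Disjoint C (Ig I j) ∧ Module.finrank k C + Module.finrank k (Ig I j) = Nat.multichoose n j := by
    intro j
    obtain ⟨C', hC'⟩ := Submodule.exists_isCompl ((Ig I j).comap (homogeneousSubmodule (Fin n) k j).subtype)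
    refine ⟨C'.map (homogeneousSubmodule (Fin n) k j).subtype, Submodule.map_subtype_le _ _, ?_, ?_⟩
    · rw [Submodule.disjoint_def]
      rintro _ ⟨y, hy, rfl⟩ h2
      have := (Submodule.disjoint_def.1 hC'.disjoint) y h2 hy
      rw [this]; simp
    · rw [← finrank_hom k, ← Submodule.finrank_add_eq_of_isCompl hC', add_comm]
      congr 1
      · have h1 : (Ig I j) = ((Ig I j).comap (homogeneousSubmodule (Fin n) k j).subtype).map (homogeneousSubmodule (Fin n) k j).subtype := by
          rw [Submodule.map_comap_subtype]
          exact (inf_eq_right.2 inf_le_left).symm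
        conv_lhs => rw [h1]
        exact (LinearEquiv.finrank_eq (Submodule.equivMapOfInjective _ (Submodule.injective_subtype _) _)).symm
      · exact (LinearEquiv.finrank_eq (Submodule.equivMapOfInjective _ (Submodule.injective_subtype _) _)).symm
  choose Cc hC1 hC2 hC3 using hcomp
  refine ⟨fun j => Module.finrank k (Cc j), B, hC3, fun J => ?_⟩
  obtain ⟨U, hUf, hU1, hU2⟩ := hB J
  refine le_trans ?_ hU1
  have hfC : ∀ j, Module.Finite k (Cc j) := fun j => Submodule.finiteDimensional_of_le (hC1 j)
  let S : (∀ t : Fin (J + 1), Cc t) →ₗ[k] MvPolynomial (Fin n) k :=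
    ∑ t : Fin (J + 1), (Cc t).subtype ∘ₗ LinearMap.proj t
  have hS : ∀ v, S v = ∑ t, (v t : MvPolynomial (Fin n) k) := by intro v; simp [S]
  have hmem : ∀ v, (Ideal.Quotient.mkₐ k I).toLinearMap (S v) ∈ U := by
    intro v
    have := hU2 (S v) (by
      rw [hS]
      refine totalDegree_finsetSum_le fun t _ => ?_
      have : ((v t : MvPolynomial (Fin n) k)).IsHomogeneous t := hC1 t (v t).2
      exact this.totalDegree_le.trans (by omega))
    rw [haev] at this
    exact this
  let Φ : (∀ t : Fin (J + 1), Cc t) →ₗ[k] U := ((Ideal.Quotient.mkₐ k I).toLinearMap ∘ₗ S).codRestrict U hmem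
  have hΦ : Function.Injective Φ := by
    rw [← LinearMap.ker_eq_bot, LinearMap.ker_eq_bot']
    intro v hv
    have h0 : Ideal.Quotient.mk I (S v) = 0 := congrArg Subtype.val hv
    rw [Ideal.Quotient.eq_zero_iff_mem] at h0
    funext t
    have h1 := hom _ h0 t
    rw [hS, map_sum, Finset.sum_eq_single t] at h1
    · have hh : ((v t : MvPolynomial (Fin n) k)).IsHomogeneous t := hC1 t (v t).2
      rw [homogeneousComponent_eq_self hh] at h1
      exact Subtype.ext (Submodule.disjoint_def.1 (hC2 t) _ (v t).2 ⟨hh, h1⟩)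
    · intro t' _ hne
      have hh : ((v t' : MvPolynomial (Fin n) k)).IsHomogeneous t' := hC1 t' (v t').2
      rw [homogeneousComponent_of_mem hh, if_neg]
      exact fun h => hne (Fin.ext h.symm)
    · simp
  have := LinearMap.finrank_le_finrank_of_injective hΦ
  rw [Module.finrank_pi_fintype, Fin.sum_univ_eq_sum_range (fun t => Module.finrank k (Cc t))] at this
  exact this

end
end LinRes


namespace LinRes
noncomputable section

lemma mc_F (d n j : ℕ) : Nat.multichoose (n + 1) (d + j)
    = ∑ m ∈ Finset.range (n + 1), Nat.multichoose d m * Nat.multichoose (n + 1 - m) j := by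
  induction d generalizing n with
  | zero =>
    rw [Finset.sum_eq_single 0]
    · simp
    · intro b _ hb
      obtain ⟨b, rfl⟩ := Nat.exists_eq_succ_of_ne_zero hb
      simp
    · simp
  | succ d ihd =>
    induction n with
    | zero => simp
    | succ n ihn =>
      rw [Finset.sum_range_succ']
      simp only [Nat.multichoose_succ_succ, add_mul, Finset.sum_add_distrib, Nat.add_sub_add_right]
      rw [← ihn, show d + 1 + j = (d + j) + 1 by ring, Nat.multichoose_succ_succ (n + 1), ihd (n + 1),
        Finset.sum_range_succ' _ (n + 1)]
      simp only [Nat.add_sub_add_right, Nat.multichoose_zero_right]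
      ring

lemma mc_sum (r J : ℕ) : ∑ j ∈ Finset.range (J + 1), Nat.multichoose r j = Nat.multichoose (r + 1) J := by
  induction J with
  | zero => simp
  | succ J ih => rw [Finset.sum_range_succ, ih, Nat.multichoose_succ_succ, add_comm]

lemma mc_mono {r r' : ℕ} (h : r ≤ r') (J : ℕ) : Nat.multichoose r J ≤ Nat.multichoose r' J := by
  induction h with
  | refl => rfl
  | step _ ih =>
    refine ih.trans ?_
    cases J with
    | zero => simp
    | succ J => rw [Nat.multichoose_succ_succ]; exact Nat.le_add_right _ _

lemma vanish {n c s B : ℕ} (hcs : c + s ≤ n) (a : ℕ → ℤ)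
    (hB : ∀ J : ℕ, |∑ m ∈ Finset.range n, a m * (Nat.multichoose (n - m + 1) J : ℤ)| ≤ B * ((J : ℤ) + 1) ^ s) :
    ∀ m, m < c → a m = 0 := by
  intro m
  induction m using Nat.strong_induction_on with
  | _ m ih =>
  intro hm
  by_contra hne
  obtain ⟨t, ht⟩ : ∃ t, n - m = t + 1 := ⟨n - m - 1, by omega⟩
  have hst : s ≤ t := by omega
  set A : ℤ := ∑ m' ∈ Finset.range n, |a m'| with hA
  have hA0 : 0 ≤ A := Finset.sum_nonneg fun _ _ => abs_nonneg _
  have hmn : m ∈ Finset.range n := Finset.mem_range.2 (by omega)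
  have key : ∀ J : ℕ, ((t : ℤ) + 1 + J) ≤ (t + 1) * (A + B * (t.factorial : ℤ)) := by
    intro J
    set M := Nat.choose (J + t) t with hM
    have hM0 : 0 < M := Nat.choose_pos (by omega)
    have e1 : Nat.multichoose (t + 1) J = M := by
      rw [Nat.multichoose_eq, show t + 1 + J - 1 = J + t by omega, hM, Nat.choose_symm_add]
    have e2 : Nat.multichoose (t + 1 + 1) J * (t + 1) = (t + 1 + J) * M := by
      rw [Nat.multichoose_eq, show t + 1 + 1 + J - 1 = J + (t + 1) by omega, Nat.choose_symm_add,
        show J + (t + 1) = (J + t) + 1 by omega, ← Nat.add_one_mul_choose_eq]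
      congr 1; omega
    have e3 : (J + 1) ^ t ≤ t.factorial * M := by
      rw [hM, ← Nat.ascFactorial_eq_factorial_mul_choose]
      exact Nat.pow_succ_le_ascFactorial (J + 1) t
    have h1 := hB J
    rw [← Finset.add_sum_erase _ _ hmn, ht] at h1
    have h2 : |∑ m' ∈ (Finset.range n).erase m, a m' * (Nat.multichoose (n - m' + 1) J : ℤ)| ≤ A * M := by
      refine (Finset.abs_sum_le_sum_abs _ _).trans ?_
      rw [hA, Finset.sum_mul]
      refine (Finset.sum_le_sum (g := fun m' => |a m'| * (M : ℤ)) fun m' hm' => ?_).trans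
        (Finset.sum_le_sum_of_subset_of_nonneg (Finset.erase_subset _ _) fun _ _ _ => by positivity)
      rw [Finset.mem_erase, Finset.mem_range] at hm'
      rcases lt_or_gt_of_ne hm'.1 with h | h
      · rw [ih m' h (by omega)]; simp
      · rw [abs_mul, Nat.abs_cast]
        refine mul_le_mul_of_nonneg_left ?_ (abs_nonneg _)
        rw [← e1]
        exact_mod_cast mc_mono (by omega) J
    have h3 : (Nat.multichoose (t + 1 + 1) J : ℤ) ≤ |a m * (Nat.multichoose (t + 1 + 1) J : ℤ)| := by
      rw [abs_mul, Nat.abs_cast]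
      have : 1 ≤ |a m| := Int.one_le_abs hne
      nlinarith [Int.natCast_nonneg (Nat.multichoose (t + 1 + 1) J)]
    have h4 : (Nat.multichoose (t + 1 + 1) J : ℤ) ≤ B * ((J : ℤ) + 1) ^ s + A * M := by
      have := abs_sub_abs_le_abs_sub (a m * (Nat.multichoose (t + 1 + 1) J : ℤ))
        (-∑ m' ∈ (Finset.range n).erase m, a m' * (Nat.multichoose (n - m' + 1) J : ℤ))
      rw [sub_neg_eq_add, abs_neg] at this
      linarith
    have h5 : ((J : ℤ) + 1) ^ s ≤ t.factorial * M := by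
      have : (J + 1) ^ s ≤ (J + 1) ^ t := Nat.pow_le_pow_right (by omega) hst
      exact_mod_cast this.trans e3
    have h6 : (Nat.multichoose (t + 1 + 1) J : ℤ) ≤ (A + B * t.factorial) * M := by
      have : (B : ℤ) * ((J : ℤ) + 1) ^ s ≤ B * (t.factorial * M) := mul_le_mul_of_nonneg_left h5 (by positivity)
      nlinarith
    have e2' : (Nat.multichoose (t + 1 + 1) J : ℤ) * (t + 1) = (t + 1 + J) * M := by exact_mod_cast e2
    have h7 : ((t : ℤ) + 1 + J) * M ≤ ((t + 1) * (A + B * (t.factorial : ℤ))) * M := by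
      rw [← e2']
      nlinarith
    exact le_of_mul_le_mul_right h7 (by exact_mod_cast hM0)
  have h := key (((t + 1) * (A + B * (t.factorial : ℤ))).toNat)
  have h' := Int.self_le_toNat ((t + 1) * (A + B * (t.factorial : ℤ)))
  have : (0 : ℤ) ≤ t := by positivity
  linarith

lemma mu_eq {n d c s B : ℕ} (hcs : c + s ≤ n) (μ h i : ℕ → ℕ)
    (hi : ∀ j, i (d + j) = ∑ m ∈ Finset.range n, μ m * Nat.multichoose (n - m) j)
    (hh : ∀ j, h j + i j = Nat.multichoose n j)
    (hB : ∀ J, ∑ j ∈ Finset.range (J + 1), h j ≤ B * (J + 1) ^ s) :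
    ∀ m, m < c → μ m = Nat.multichoose d m := by
  intro m hm
  obtain ⟨n, rfl⟩ : ∃ n', n = n' + 1 := ⟨n - 1, by omega⟩
  have hf : ∀ j, (h (d + j) : ℤ) = ∑ m ∈ Finset.range (n + 1),
      ((Nat.multichoose d m : ℤ) - μ m) * (Nat.multichoose (n + 1 - m) j : ℤ) := by
    intro j
    have h1 := hh (d + j)
    rw [hi, mc_F] at h1
    simp only [sub_mul, Finset.sum_sub_distrib]
    have h2 : ((h (d + j) + ∑ m ∈ Finset.range (n + 1), μ m * Nat.multichoose (n + 1 - m) j : ℕ) : ℤ) = 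
      ((∑ m ∈ Finset.range (n + 1), Nat.multichoose d m * Nat.multichoose (n + 1 - m) j : ℕ) : ℤ) := by rw [h1]
    push_cast at h2
    linarith
  have := vanish (B := B * (d + 1) ^ s) hcs (fun m => (Nat.multichoose d m : ℤ) - μ m) (by
    intro J
    have h1 : ∑ m ∈ Finset.range (n + 1), ((Nat.multichoose d m : ℤ) - μ m) * (Nat.multichoose (n + 1 - m + 1) J : ℤ)
        = ((∑ j ∈ Finset.range (J + 1), h (d + j) : ℕ) : ℤ) := by
      push_cast
      simp only [hf]
      rw [Finset.sum_comm]
      refine Finset.sum_congr rfl fun m _ => ?_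
      rw [← Finset.mul_sum, ← mc_sum]
      push_cast
      rfl
    rw [h1, Nat.abs_cast]
    have h2 : ∑ j ∈ Finset.range (J + 1), h (d + j) ≤ ∑ j ∈ Finset.range (d + J + 1), h j := by
      rw [add_assoc, Finset.sum_range_add h d (J + 1)]
      exact Nat.le_add_left _ _
    have h3 : B * (d + J + 1) ^ s ≤ B * (d + 1) ^ s * (J + 1) ^ s := by
      rw [mul_assoc, ← mul_pow]
      exact Nat.mul_le_mul_left _ (Nat.pow_le_pow_left (by nlinarith) _)
    exact_mod_cast (h2.trans (hB _)).trans h3) m hm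
  have h' : (Nat.multichoose d m : ℤ) = μ m := by linarith
  exact_mod_cast h'.symm

lemma sum_choose (a c : ℕ) : ∑ m ∈ Finset.range a, Nat.choose m c = Nat.choose a (c + 1) := by
  induction a with
  | zero => simp
  | succ a ih => rw [Finset.sum_range_succ, ih, Nat.choose_succ_succ, add_comm]

lemma numerics {n d c p : ℕ} (hd : 1 ≤ d) (hc : 2 ≤ c) (hcn : c ≤ n) (μ b : ℕ → ℕ)
    (hb : ∀ a, b (a + 1) = ∑ m ∈ Finset.range n, μ m * Nat.choose m a)
    (hdec : ∀ m, m + 1 < n → μ (m + 1) ≠ 0 → μ m ≠ 0)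
    (hν : ∀ m, m < c → μ m = Nat.multichoose d m) (hp : b p ≠ 0) :
    max p (Nat.choose (d + c - 1) (c - 1)) ≤ b 1 ∧
    max (Nat.choose p c) (Nat.choose (d + c - 2) (c - 1)) ≤ b c := by
  obtain ⟨c, rfl⟩ : ∃ c', c = c' + 1 := ⟨c - 1, by omega⟩
  have hb1 : b 1 = ∑ m ∈ Finset.range n, μ m := by
    rw [hb 0]; simp
  have hpos : ∀ a, p = a + 1 → a < n ∧ ∀ m, m ≤ a → 1 ≤ μ m := by
    rintro a rfl
    rw [hb] at hp
    obtain ⟨m, hm, hne⟩ := Finset.exists_ne_zero_of_sum_ne_zero hp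
    rw [Finset.mem_range] at hm
    have h1 : μ m ≠ 0 := left_ne_zero_of_mul hne
    have h2 : a ≤ m := by
      by_contra h
      exact right_ne_zero_of_mul hne (Nat.choose_eq_zero_of_lt (by omega))
    refine ⟨by omega, fun m' hm' => Nat.one_le_iff_ne_zero.2 ?_⟩
    have h3 : m' ≤ m := by omega
    revert hm h1
    clear hne h2
    induction h3 with
    | refl => exact fun _ h => h
    | step _ ih => exact fun hm h => ih (by omega) (hdec _ hm h)
  refine ⟨max_le ?_ ?_, max_le ?_ ?_⟩
  · cases p with
    | zero => simp
    | succ a =>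
      obtain ⟨h1, h2⟩ := hpos a rfl
      rw [hb1]
      calc a + 1 = ∑ m ∈ Finset.range (a + 1), 1 := by simp
        _ ≤ ∑ m ∈ Finset.range (a + 1), μ m :=
          Finset.sum_le_sum fun m hm => h2 m (by have := Finset.mem_range.1 hm; omega)
        _ ≤ _ := Finset.sum_le_sum_of_subset (Finset.range_subset_range.2 (by omega))
  · rw [hb1]
    calc Nat.choose (d + (c + 1) - 1) (c + 1 - 1) = Nat.multichoose (d + 1) c := by
          rw [Nat.multichoose_eq]; congr 1; omega
      _ = ∑ m ∈ Finset.range (c + 1), Nat.multichoose d m := (mc_sum _ _).symm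
      _ = ∑ m ∈ Finset.range (c + 1), μ m :=
          Finset.sum_congr rfl fun m hm => (hν m (Finset.mem_range.1 hm)).symm
      _ ≤ _ := Finset.sum_le_sum_of_subset (Finset.range_subset_range.2 (by omega))
  · cases p with
    | zero => simp
    | succ a =>
      obtain ⟨h1, h2⟩ := hpos a rfl
      rw [hb, ← sum_choose]
      calc ∑ m ∈ Finset.range (a + 1), Nat.choose m c
        _ ≤ ∑ m ∈ Finset.range (a + 1), μ m * Nat.choose m c :=
          Finset.sum_le_sum fun m hm => Nat.le_mul_of_pos_left _ (h2 m (by have := Finset.mem_range.1 hm; omega))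
        _ ≤ _ := Finset.sum_le_sum_of_subset (Finset.range_subset_range.2 (by omega))
  · rw [hb]
    calc Nat.choose (d + (c + 1) - 2) (c + 1 - 1) = μ c * Nat.choose c c := by
          rw [hν c (by omega), Nat.multichoose_eq, Nat.choose_self, mul_one]; congr 1
      _ ≤ _ := Finset.single_le_sum (f := fun m => μ m * Nat.choose m c) (fun _ _ => Nat.zero_le _)
        (Finset.mem_range.2 (by omega))

end
end LinRes


namespace LinRes
noncomputable section
open MvPolynomial Matrix

/-- matrix of a map of free modules -/
def mat {A ι κ : Type*} [CommRing A] (L : (κ →₀ A) →ₗ[A] (ι →₀ A)) : Matrix ι κ A :=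
  fun i j => L (Finsupp.single j 1) i

lemma mat_mulVec {A ι κ : Type*} [CommRing A] [Fintype κ] (L : (κ →₀ A) →ₗ[A] (ι →₀ A))
    (u : κ →₀ A) : mat L *ᵥ (u : κ → A) = (L u : ι → A) := by
  funext i
  conv_rhs => rw [← Finsupp.univ_sum_single u]
  simp only [mulVec, dotProduct, mat, map_sum, Finsupp.finsetSum_apply]
  refine Finset.sum_congr rfl fun j _ => ?_
  rw [← Finsupp.smul_single_one j (u j), map_smul, Finsupp.smul_apply, smul_eq_mul, mul_comm]

lemma mat_mulVec' {A ι κ : Type*} [CommRing A] [Fintype κ] (L : (κ →₀ A) →ₗ[A] (ι →₀ A))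
    (u : κ → A) : mat L *ᵥ u = (L (Finsupp.equivFunOnFinite.symm u) : ι → A) := by
  rw [← mat_mulVec]; rfl

/-- the finite type structure -/
def finSig (b : ℤ → ℕ) (hb : (Function.support b).Finite) : Fintype ((j : ℤ) × Fin (b j)) where
  elems := hb.toFinset.sigma fun _ => Finset.univ
  complete := fun x => by
    rw [Finset.mem_sigma]
    refine ⟨?_, Finset.mem_univ _⟩
    rw [Set.Finite.mem_toFinset, Function.mem_support]
    have := x.2.2
    omega

lemma card_finSig (b : ℤ → ℕ) (hb : (Function.support b).Finite) :
    @Fintype.card _ (finSig b hb) = ∑ j ∈ hb.toFinset, b j := by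
  change (hb.toFinset.sigma fun _ => Finset.univ).card = _
  rw [Finset.card_sigma]
  simp

section
variable {k : Type} [Field k] {n : ℕ} {I : Ideal (MvPolynomial (Fin n) k)} {d : ℕ}
  (res : MinGradedFreeRes (MvPolynomial (Fin n) k)
      (fun m => {f | MvPolynomial.IsHomogeneous f m})
      (MvPolynomial (Fin n) k ⧸ I))

lemma mat_hom0 (h0 : ∀ j : ℤ, res.β 0 j = if j = 0 then 1 else 0)
    (h1 : ∀ j : ℤ, res.β 1 j ≠ 0 → j = (d : ℤ)) (x y) :
    (mat (res.d 0) x y).IsHomogeneous d := by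
  obtain ⟨j, b⟩ := y
  obtain ⟨j', b'⟩ := x
  have e1 : j = d := h1 j (by have := b.2; intro h; change _ < res.β 1 j at this; omega)
  have e2 : j' = 0 := by
    by_contra hne
    have := h0 j'
    rw [if_neg hne] at this
    have := b'.2
    omega
  rcases res.graded 0 j b j' b' with h | ⟨m, hm, h⟩
  · rw [mat, h]; exact isHomogeneous_zero _ _ _
  · have : m = d := by omega
    subst this
    exact h

lemma mat_hom1 (hlin : ∀ i : ℕ, 1 ≤ i → ∀ j : ℤ, res.β i j ≠ 0 → j = (d : ℤ) + i - 1) (a x y) :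
    (mat (res.d (a + 1)) x y).IsHomogeneous 1 := by
  obtain ⟨j, b⟩ := y
  obtain ⟨j', b'⟩ := x
  have e1 := hlin (a + 1 + 1) (by omega) j (by have := b.2; omega)
  have e2 := hlin (a + 1) (by omega) j' (by have := b'.2; omega)
  rcases res.graded (a + 1) j b j' b' with h | ⟨m, hm, h⟩
  · rw [mat, h]; exact isHomogeneous_zero _ _ _
  · have : m = 1 := by push_cast at e1 e2; omega
    subst this
    exact h

lemma mat_exact (a : ℕ) [Fintype ((j : ℤ) × Fin (res.β (a + 1) j))]
    [Fintype ((j : ℤ) × Fin (res.β (a + 1 + 1) j))]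
    (u : ((j : ℤ) × Fin (res.β (a + 1) j)) → MvPolynomial (Fin n) k) :
    mat (res.d a) *ᵥ u = 0 ↔ ∃ v, u = mat (res.d (a + 1)) *ᵥ v := by
  rw [mat_mulVec']
  have h := res.exact a
  have h2 : Finsupp.equivFunOnFinite.symm u ∈ LinearMap.ker (res.d a) ↔
    Finsupp.equivFunOnFinite.symm u ∈ LinearMap.range (res.d (a + 1)) := by rw [h]
  rw [LinearMap.mem_ker, LinearMap.mem_range] at h2
  constructor
  · intro hu
    obtain ⟨v, hv⟩ := h2.1 (DFunLike.coe_injective hu)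
    refine ⟨v, ?_⟩
    rw [mat_mulVec, hv]; rfl
  · rintro ⟨v, hv⟩
    rw [h2.2 ⟨Finsupp.equivFunOnFinite.symm v, ?_⟩]
    · rfl
    · apply DFunLike.coe_injective
      rw [← mat_mulVec', ← hv]; rfl

/-- the linear complex -/
def toLCx (h0 : ∀ j : ℤ, res.β 0 j = if j = 0 then 1 else 0)
    (h1 : ∀ j : ℤ, res.β 1 j ≠ 0 → j = (d : ℤ))
    (hlin : ∀ i : ℕ, 1 ≤ i → ∀ j : ℤ, res.β i j ≠ 0 → j = (d : ℤ) + i - 1) : LCx k n d where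
  ι a := (j : ℤ) × Fin (res.β a j)
  fin a := finSig _ (res.finβ a)
  D a := mat (res.d a)
  hD0 := mat_hom0 res h0 h1
  hD := mat_hom1 res hlin
  DD a := by
    let _ := fun a => finSig _ (res.finβ a)
    apply Matrix.ext_of_mulVec_single
    intro i
    rw [← mulVec_mulVec, zero_mulVec]
    exact (mat_exact res a _).2 ⟨_, rfl⟩
  lin a t u _ h := by
    let _ := fun a => finSig _ (res.finβ a)
    exact (mat_exact res a _).1 h

lemma toLCx_inj (h0 : ∀ j : ℤ, res.β 0 j = if j = 0 then 1 else 0)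
    (h1 : ∀ j : ℤ, res.β 1 j ≠ 0 → j = (d : ℤ))
    (hlin : ∀ i : ℕ, 1 ≤ i → ∀ j : ℤ, res.β i j ≠ 0 → j = (d : ℤ) + i - 1) :
    (toLCx res h0 h1 hlin).Inj0 := by
  intro a u hu h
  let _ := fun a => finSig _ (res.finβ a)
  obtain ⟨v, hv⟩ := (mat_exact res a u).1 h
  funext i
  have h2 : coeff 0 (u i) = 0 := by
    rw [hv]
    simp only [mulVec, dotProduct, coeff_sum]
    refine Finset.sum_eq_zero fun j _ => ?_
    have := mat_hom1 res hlin a i j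
    rw [← constantCoeff_eq, map_mul, constantCoeff_eq, this.coeff_eq_zero (by simp), zero_mul]
  have h3 := (totalDegree_zero_iff_isHomogeneous _).2 (hu i)
  rw [totalDegree_eq_zero_iff_eq_C.1 h3, h2]
  simp

lemma exact_zero [Fintype ((j : ℤ) × Fin (res.β 1 j))]
    (h0 : ∀ j : ℤ, res.β 0 j = if j = 0 then 1 else 0) :
    ∃ e : (j : ℤ) × Fin (res.β 0 j), (∀ x, x = e) ∧
      ∀ f, f ∈ I ↔ ∃ v, f = (mat (res.d 0) *ᵥ v) e := by
  have hz : res.β 0 0 = 1 := by rw [h0]; simp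
  refine ⟨⟨0, ⟨0, by omega⟩⟩, ?_, ?_⟩
  · rintro ⟨j, b⟩
    have hj : j = 0 := by
      by_contra hne
      have := h0 j
      rw [if_neg hne] at this
      have := b.2
      omega
    subst hj
    congr 1
    ext
    have := b.2
    simp only
    omega
  · have hu : ∀ x : (j : ℤ) × Fin (res.β 0 j), x = ⟨0, ⟨0, by omega⟩⟩ := by
      rintro ⟨j, b⟩
      have hj : j = 0 := by
        by_contra hne
        have := h0 j
        rw [if_neg hne] at this
        have := b.2
        omega
      subst hj
      congr 1
      ext
      have := b.2
      simp only
      omega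
    generalize (⟨0, ⟨0, by omega⟩⟩ : (j : ℤ) × Fin (res.β 0 j)) = e at hu ⊢
    have hs : ∀ w : FreeMod (MvPolynomial (Fin n) k) (res.β 0), w = w e • Finsupp.single e 1 := by
      intro w
      ext1 x
      rw [hu x]
      simp
    intro f
    have key : f ∈ I ↔ Finsupp.single e f ∈ LinearMap.ker res.aug := by
      rw [LinearMap.mem_ker, ← Finsupp.smul_single_one, map_smul]
      constructor
      · intro hf
        obtain ⟨y, hy⟩ := Ideal.Quotient.mk_surjective (res.aug (Finsupp.single e 1))
        rw [← hy]
        change Ideal.Quotient.mk I (f * y) = 0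
        exact Ideal.Quotient.eq_zero_iff_mem.2 (I.mul_mem_right _ hf)
      · intro hf
        obtain ⟨w, hw⟩ := res.augSurj 1
        rw [hs w, map_smul] at hw
        have : f • (1 : MvPolynomial (Fin n) k ⧸ I) = 0 := by
          rw [← hw, smul_comm, hf, smul_zero]
        have h2 : Ideal.Quotient.mk I (f * 1) = 0 := this
        rw [mul_one] at h2
        exact Ideal.Quotient.eq_zero_iff_mem.1 h2
    rw [key, ← res.exact₀, LinearMap.mem_range]
    constructor
    · rintro ⟨v, hv⟩
      refine ⟨v, ?_⟩
      rw [mat_mulVec, hv]; simp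
    · rintro ⟨v, hv⟩
      refine ⟨Finsupp.equivFunOnFinite.symm v, ?_⟩
      rw [mat_mulVec'] at hv
      rw [hs (res.d 0 _), ← hv, Finsupp.smul_single_one]

lemma finrank_Ig (h0 : ∀ j : ℤ, res.β 0 j = if j = 0 then 1 else 0)
    (h1 : ∀ j : ℤ, res.β 1 j ≠ 0 → j = (d : ℤ))
    (hlin : ∀ i : ℕ, 1 ≤ i → ∀ j : ℤ, res.β i j ≠ 0 → j = (d : ℤ) + i - 1) (j : ℕ) :
    Module.finrank k (Ig I (d + j)) = Module.finrank k (G ((toLCx res h0 h1 hlin).D 0) j) := by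
  let _ := fun a => finSig _ (res.finβ a)
  obtain ⟨e, he, hI⟩ := exact_zero res h0
  let φ : ((toLCx res h0 h1 hlin).ι 0 → MvPolynomial (Fin n) k) →ₗ[k] MvPolynomial (Fin n) k :=
    LinearMap.proj e
  have hφ : Function.Injective φ := by
    intro a b hab
    funext x
    rw [he x]; exact hab
  have : Ig I (d + j) = (G ((toLCx res h0 h1 hlin).D 0) j).map φ := by
    ext f
    rw [Submodule.mem_map, Ig, Submodule.mem_inf, mem_homogeneousSubmodule]
    constructor
    · rintro ⟨hf, hfI⟩
      obtain ⟨v, hv⟩ := (hI f).1 hfI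
      refine ⟨_, (mem_G _ _ _).2 ⟨hcv j v, hcv_HV _ _, rfl⟩, ?_⟩
      have h3 : hcv (d + j) (mat (res.d 0) *ᵥ v) e = (mat (res.d 0) *ᵥ hcv j v) e :=
        congrFun (hcv_mulVec _ (mat_hom0 res h0 h1) j v) e
      refine Eq.trans h3.symm ?_
      change homogeneousComponent (d + j) ((mat (res.d 0) *ᵥ v) e) = f
      rw [← hv, homogeneousComponent_eq_self hf]
    · rintro ⟨u, hu, rfl⟩
      obtain ⟨v, hv, rfl⟩ := (mem_G _ _ _).1 hu
      exact ⟨HV.mulVec (toLCx res h0 h1 hlin).hD0 hv e, (hI _).2 ⟨v, rfl⟩⟩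
  rw [this]
  exact (LinearEquiv.finrank_eq (Submodule.equivMapOfInjective φ hφ _)).symm

end

lemma hom_of_gen {k : Type} [Field k] {n : ℕ} {I : Ideal (MvPolynomial (Fin n) k)} {d : ℕ}
    (hgen : ∃ G : Set (MvPolynomial (Fin n) k),
      (∀ g ∈ G, MvPolynomial.IsHomogeneous g d) ∧ Ideal.span G = I) :
    ∀ f ∈ I, ∀ j, homogeneousComponent j f ∈ I := by
  obtain ⟨G, hG, rfl⟩ := hgen
  let _ : GradedAlgebra (homogeneousSubmodule (Fin n) k) := MvPolynomial.gradedAlgebra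
  have h := Ideal.homogeneous_span (homogeneousSubmodule (Fin n) k) G (fun g hg => ⟨d, hG g hg⟩)
  intro f hf j
  have := h j hf
  rw [← decomposition.decompose'_apply]
  exact this

lemma d_pos {k : Type} [Field k] {n : ℕ} {I : Ideal (MvPolynomial (Fin n) k)} {d c : ℕ}
    (hgen : ∃ G : Set (MvPolynomial (Fin n) k),
      (∀ g ∈ G, MvPolynomial.IsHomogeneous g d) ∧ Ideal.span G = I) (hc : 2 ≤ c)
    (hI : I ≠ ⊤)
    (hht : ∀ P : PrimeSpectrum (MvPolynomial (Fin n) k), I ≤ P.asIdeal → (c : ℕ∞) ≤ Order.height P) :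
    1 ≤ d := by
  by_contra hd
  have hd0 : d = 0 := by omega
  subst hd0
  obtain ⟨G, hG, rfl⟩ := hgen
  have hbot : Ideal.span G = ⊥ := by
    rw [Ideal.span_eq_bot]
    intro g hg
    by_contra hne
    have h3 := (totalDegree_zero_iff_isHomogeneous _).2 (hG g hg)
    have h4 := totalDegree_eq_zero_iff_eq_C.1 h3
    apply hI
    refine Ideal.eq_top_of_isUnit_mem _ (Ideal.subset_span hg) ?_
    rw [h4]
    refine IsUnit.map C (isUnit_iff_ne_zero.2 fun h5 => hne ?_)
    rw [h4, h5, C_0]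
  have := hht ⟨⊥, Ideal.isPrime_bot⟩ (by rw [hbot])
  have h6 : Order.height (⟨⊥, Ideal.isPrime_bot⟩ : PrimeSpectrum (MvPolynomial (Fin n) k)) = 0 := by
    rw [Order.height_eq_zero]
    intro x _
    exact (bot_le : (⊥ : Ideal _) ≤ x.asIdeal)
  rw [h6] at this
  have h7 : (c : ℕ∞) = 0 := le_antisymm this bot_le
  have : c = 0 := by exact_mod_cast h7
  omega

end
end LinRes

theorem linear_resolution_lower_bounds
    (k : Type) [Field k] (n : ℕ) (I : Ideal (MvPolynomial (Fin n) k)) (d : ℕ)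
    (hgen : ∃ G : Set (MvPolynomial (Fin n) k),
      (∀ g ∈ G, MvPolynomial.IsHomogeneous g d) ∧ Ideal.span G = I)
    (res : MinGradedFreeRes (MvPolynomial (Fin n) k)
      (fun m => {f | MvPolynomial.IsHomogeneous f m})
      (MvPolynomial (Fin n) k ⧸ I))
    (h0 : ∀ j : ℤ, res.β 0 j = if j = 0 then 1 else 0)
    (h1 : ∀ j : ℤ, res.β 1 j ≠ 0 → j = (d : ℤ))
    (p : ℕ) (hlen : ∀ i, p < i → res.β i = 0) (hp : res.β p ≠ 0)
    (c : ℕ) (hc : 2 ≤ c) (hht : idealHeight I = (c : ℕ∞))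
    (hlin : ∀ i : ℕ, 1 ≤ i → ∀ j : ℤ, res.β i j ≠ 0 → j = (d : ℤ) + i - 1) :
    max p (Nat.choose (d + c - 1) (c - 1)) ≤ res.tB 1 ∧
    max (Nat.choose p c) (Nat.choose (d + c - 2) (c - 1)) ≤ res.tB c := by
  have hht' : ∀ P : PrimeSpectrum (MvPolynomial (Fin n) k), I ≤ P.asIdeal →
      (c : ℕ∞) ≤ Order.height P := by
    intro P hP
    rw [← hht]
    exact iInf₂_le P hP
  have hI : I ≠ ⊤ := by
    rintro rfl
    have : idealHeight (⊤ : Ideal (MvPolynomial (Fin n) k)) = ⊤ := by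
      unfold idealHeight
      simp only [iInf_eq_top]
      intro P hP
      exact absurd (top_le_iff.1 hP) P.2.ne_top
    rw [this] at hht
    exact absurd hht.symm (ENat.natCast_ne_top c)
  have hd := LinRes.d_pos hgen hc hI hht'
  obtain ⟨s, hcs, h, B, hh, hB⟩ := LinRes.growth I hI (LinRes.hom_of_gen hgen) hht'
  obtain ⟨μ, hμ, hdec, hb⟩ := LinRes.main_any hd (LinRes.toLCx res h0 h1 hlin)
    (LinRes.toLCx_inj res h0 h1 hlin)
  have hν := LinRes.mu_eq hcs μ h (fun j => Module.finrank k (LinRes.Ig I j))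
    (fun j => (LinRes.finrank_Ig res h0 h1 hlin j).trans (hμ j)) hh hB
  refine LinRes.numerics hd hc (by omega) μ res.tB
    (fun a => (LinRes.card_finSig _ (res.finβ (a + 1))).symm.trans (hb a)) hdec hν ?_
  obtain ⟨j, hj⟩ := Function.ne_iff.1 hp
  intro h
  rw [MinGradedFreeRes.tB, Finset.sum_eq_zero_iff] at h
  exact hj (h j (by simpa using hj))
end

section
/- Let I ⊂ S be a homogeneous ideal of height c ≥ 2 generated in degree d satisfying condition N_{d,q} (the minimal resolution of S/I is d-linear up to homological step q). Set c' = min{c, q}. Then μ(I) ≥ C(d + c' − 1, c' − 1). -/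
namespace NdqAux
open MvPolynomial

/-- linear form with given coefficients -/
noncomputable def lin (K : Type) [Field K] (n : ℕ) : (Fin n → K) →ₗ[K] MvPolynomial (Fin n) K :=
  Fintype.linearCombination K (fun i => (X i : MvPolynomial (Fin n) K))

lemma lin_apply (K : Type) [Field K] (n : ℕ) (a : Fin n → K) :
    lin K n a = ∑ i, a i • (X i : MvPolynomial (Fin n) K) := by
  simp [lin, Fintype.linearCombination_apply]

lemma lin_hom (K : Type) [Field K] (n : ℕ) (a : Fin n → K) : (lin K n a).IsHomogeneous 1 := by
  rw [lin_apply]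
  refine IsHomogeneous.sum _ _ _ fun i _ => ?_
  rw [smul_eq_C_mul]
  exact isHomogeneous_C_mul_X _ _

lemma lin_single (K : Type) [Field K] (n : ℕ) (i : Fin n) : lin K n (Pi.single i 1) = X i := by
  simp [lin]

lemma ker_eq (K : Type) [Field K] (n : ℕ) :
    RingHom.ker (constantCoeff : MvPolynomial (Fin n) K →+* K) =
      Ideal.span (Set.range (X : Fin n → MvPolynomial (Fin n) K)) := by
  ext f
  rw [← Set.image_univ, mem_ideal_span_X_image, RingHom.mem_ker, constantCoeff_eq]
  constructor
  · intro h m hm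
    by_contra! hh
    have : m = 0 := by ext i; simpa using hh i
    subst this
    simp [h] at hm
  · intro h
    by_contra hh
    obtain ⟨i, _, hi⟩ := h 0 (by simpa [mem_support_iff] using hh)
    simp at hi

lemma height_ker_le (K : Type) [Field K] (n : ℕ) :
    (RingHom.ker (constantCoeff : MvPolynomial (Fin n) K →+* K)).height ≤ n := by
  refine (Ideal.height_le_spanFinrank _ (RingHom.ker_ne_top _)).trans ?_
  rw [ker_eq]
  norm_cast
  refine (Submodule.spanFinrank_span_le_ncard_of_finite (Set.finite_range _)).trans ?_
  rw [← Set.image_univ]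
  refine (Set.ncard_image_le Set.finite_univ).trans ?_
  simp [Set.ncard_univ]

lemma ker_le_iff (K : Type) [Field K] (n : ℕ) (P : Ideal (MvPolynomial (Fin n) K)) :
    RingHom.ker (constantCoeff : MvPolynomial (Fin n) K →+* K) ≤ P ↔ ∀ a, lin K n a ∈ P := by
  constructor
  · intro h a
    apply h
    rw [RingHom.mem_ker, lin_apply]
    simp [map_sum, smul_eq_C_mul]
  · intro h
    rw [ker_eq, Ideal.span_le]
    rintro _ ⟨i, rfl⟩
    rw [← lin_single]; exact h _

lemma avoid (K : Type) [Field K] [Infinite K] (n : ℕ) (J : Ideal (MvPolynomial (Fin n) K)) (h : ℕ)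
    (hJ : ∀ P : Ideal (MvPolynomial (Fin n) K), P.IsPrime → J ≤ P →
      (∀ a, lin K n a ∈ P) ∨ (h : ℕ∞) ≤ P.height) :
    ∃ l, ∀ P : Ideal (MvPolynomial (Fin n) K), P.IsPrime → J ⊔ Ideal.span {lin K n l} ≤ P →
      (∀ a, lin K n a ∈ P) ∨ ((h + 1 : ℕ) : ℕ∞) ≤ P.height := by
  classical
  have hfin := J.finite_minimalPrimes_of_isNoetherianRing (MvPolynomial (Fin n) K)
  let sp : Ideal (MvPolynomial (Fin n) K) → Submodule K (Fin n → K) := fun P =>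
    (P.restrictScalars K).comap (lin K n)
  let s : Finset (Submodule K (Fin n → K)) := (hfin.toFinset.image sp).filter (fun W => W ≠ ⊤)
  have hs : (⊤ : Submodule K (Fin n → K)) ∉ s := by simp [s]
  have := Subspace.biUnion_ne_univ_of_top_notMem hs
  rw [Set.ne_univ_iff_exists_notMem] at this
  obtain ⟨l, hl⟩ := this
  refine ⟨l, fun P hP hle => ?_⟩
  obtain ⟨P₀, hP₀, hle₀⟩ := Ideal.exists_minimalPrimes_le (le_sup_left.trans hle)
  have hpr : P₀.IsPrime := hP₀.1.1
  rcases hJ P₀ hpr hP₀.1.2 with h1 | h1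
  · exact Or.inl fun a => hle₀ (h1 a)
  by_cases htop : ∀ a, lin K n a ∈ P₀
  · exact Or.inl fun a => hle₀ (htop a)
  right
  have hlP₀ : lin K n l ∉ P₀ := by
    intro hmem
    apply hl
    simp only [Set.mem_iUnion]
    refine ⟨sp P₀, ?_, hmem⟩
    simp only [s, Finset.mem_filter, Finset.mem_image, Set.Finite.mem_toFinset]
    refine ⟨⟨P₀, hP₀, rfl⟩, fun ht => htop fun a => ?_⟩
    have : a ∈ sp P₀ := by rw [ht]; trivial
    exact this
  have hlP : lin K n l ∈ P := hle (Ideal.mem_sup_right (Ideal.mem_span_singleton_self _))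
  have hlt : P₀ < P := lt_of_le_of_ne hle₀ (by rintro rfl; exact hlP₀ hlP)
  refine le_trans ?_ (Ideal.height_add_one_le_of_lt_of_isPrime hlt)
  push_cast
  gcongr

lemma avoid_many (K : Type) [Field K] [Infinite K] (n : ℕ) (J : Ideal (MvPolynomial (Fin n) K))
    (h : ℕ)
    (hJ : ∀ P : Ideal (MvPolynomial (Fin n) K), P.IsPrime → J ≤ P →
      (∀ a, lin K n a ∈ P) ∨ (h : ℕ∞) ≤ P.height) (r : ℕ) :
    ∃ l : Fin r → (Fin n → K), ∀ P : Ideal (MvPolynomial (Fin n) K), P.IsPrime →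
      J ⊔ Ideal.span (Set.range fun i => lin K n (l i)) ≤ P →
      (∀ a, lin K n a ∈ P) ∨ ((h + r : ℕ) : ℕ∞) ≤ P.height := by
  induction r with
  | zero => exact ⟨Fin.elim0, fun P hP hle => hJ P hP (le_sup_left.trans hle)⟩
  | succ r ih =>
    obtain ⟨l, hl⟩ := ih
    obtain ⟨l', hl'⟩ := avoid K n _ _ hl
    refine ⟨Fin.snoc l l', fun P hP hle => hl' P hP (le_trans ?_ hle)⟩
    rw [sup_assoc]
    refine sup_le_sup le_rfl (sup_le ?_ ?_)
    · rw [Ideal.span_le]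
      rintro _ ⟨i, rfl⟩
      exact Ideal.subset_span ⟨i.castSucc, by simp⟩
    · rw [Ideal.span_singleton_le_iff_mem]
      exact Ideal.subset_span ⟨Fin.last r, by simp⟩

attribute [local instance] MvPolynomial.gradedAlgebra

lemma lin_pow_mem (K : Type) [Field K] (n : ℕ) (J : Ideal (MvPolynomial (Fin n) K))
    (hhom : J.IsHomogeneous (homogeneousSubmodule (Fin n) K))
    (hJ : ∀ P : Ideal (MvPolynomial (Fin n) K), P.IsPrime → J ≤ P →
      (∀ a, lin K n a ∈ P) ∨ (n : ℕ∞) ≤ P.height) (a : Fin n → K) :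
    ∃ N : ℕ, lin K n a ^ N ∈ J := by
  set M := RingHom.ker (constantCoeff : MvPolynomial (Fin n) K →+* K) with hM
  have hMp : M.IsPrime := RingHom.ker_isPrime _
  let T : Submonoid (MvPolynomial (Fin n) K) := Submonoid.powers (lin K n a) ⊔ M.primeCompl
  by_cases hd : Disjoint (J : Set (MvPolynomial (Fin n) K)) T
  · exfalso
    obtain ⟨P, hP, hJP, hPd⟩ := J.exists_le_prime_disjoint T hd
    have hPM : P ≤ M := by
      intro x hx
      by_contra hxM
      exact Set.disjoint_left.1 hPd hx (SetLike.le_def.1 (le_sup_right) hxM)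
    have haP : lin K n a ∉ P := fun hx =>
      Set.disjoint_left.1 hPd hx (SetLike.le_def.1 le_sup_left (Submonoid.mem_powers _))
    rcases hJ P hP hJP with h | h
    · exact haP (h a)
    · have haM : lin K n a ∈ M := (ker_le_iff K n M).1 le_rfl a
      have hlt : P < M := lt_of_le_of_ne hPM (by rintro rfl; exact haP haM)
      have h1 := Ideal.height_add_one_le_of_lt_of_isPrime hlt
      have h2 := h1.trans (height_ker_le K n)
      have h3 : (n : ℕ∞) + 1 ≤ n := (by gcongr : (n : ℕ∞) + 1 ≤ P.height + 1).trans h2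
      norm_cast at h3
      omega
  · rw [Set.not_disjoint_iff] at hd
    obtain ⟨x, hxJ, hxT⟩ := hd
    obtain ⟨y, hy, s, hs, rfl⟩ := Submonoid.mem_sup.1 hxT
    obtain ⟨N, rfl⟩ := hy
    refine ⟨N, ?_⟩
    have h1 := homogeneousComponent_mem_of_mem hhom hxJ N
    have hhN : (lin K n a ^ N).IsHomogeneous N := by simpa using (lin_hom K n a).pow N
    have h2 : homogeneousComponent N (lin K n a ^ N * s) = lin K n a ^ N * C (coeff 0 s) := by
      have := DirectSum.coe_decompose_mul_of_left_mem_of_le (homogeneousSubmodule (Fin n) K)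
        (b := s) ((mem_homogeneousSubmodule N _).2 hhN) (le_refl N)
      rw [Nat.sub_self] at this
      rw [← homogeneousComponent_zero]
      erw [decomposition.decompose'_apply, decomposition.decompose'_apply] at this
      exact this
    rw [h2] at h1
    have hs0 : coeff 0 s ≠ 0 := fun h => hs (by simpa [hM, RingHom.mem_ker, constantCoeff_eq] using h)
    have h3 := J.mul_mem_right (C (coeff 0 s)⁻¹) h1
    rwa [mul_assoc, ← C_mul, mul_inv_cancel₀ hs0, C_1, mul_one] at h3

section
attribute [local instance] MvPolynomial.algebraMvPolynomial

lemma height_comap_le' (k K : Type) [Field k] [Field K] [Algebra k K] (n : ℕ)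
    (P : Ideal (MvPolynomial (Fin n) K)) [P.IsPrime] :
    (P.comap (MvPolynomial.map (algebraMap k K))).height ≤ P.height := by
  have : Module.Flat (MvPolynomial (Fin n) k) (MvPolynomial (Fin n) K) :=
    Module.Flat.isBaseChange k (MvPolynomial (Fin n) k) K _
      (Algebra.IsPushout.out (R := k) (S := MvPolynomial (Fin n) k) (R' := K)
        (S' := MvPolynomial (Fin n) K))
  have hl : P.LiesOver (P.comap (algebraMap (MvPolynomial (Fin n) k) (MvPolynomial (Fin n) K))) :=
    ⟨rfl⟩
  have hp : (P.comap (algebraMap (MvPolynomial (Fin n) k) (MvPolynomial (Fin n) K))).IsPrime :=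
    Ideal.comap_isPrime _ _
  have := Ideal.height_eq_height_add_of_liesOver_of_hasGoingDown
    (P.comap (algebraMap (MvPolynomial (Fin n) k) (MvPolynomial (Fin n) K))) P
  rw [this]
  exact le_self_add
end

lemma exists_quot (K : Type) [Field K] (n m r : ℕ) (hr : r + m ≤ n) (l : Fin r → (Fin n → K)) :
    ∃ θ : (Fin n → K) →ₗ[K] (Fin m → K), Function.Surjective θ ∧ ∀ i, θ (l i) = 0 := by
  set W := Submodule.span K (Set.range l) with hW
  have h1 : Module.finrank K W ≤ r := by
    simpa [Set.finrank] using finrank_range_le_card (R := K) l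
  have h2 := Submodule.finrank_quotient_add_finrank W
  simp only [Module.finrank_fin_fun] at h2
  have h3 : m ≤ Module.finrank K ((Fin n → K) ⧸ W) := by omega
  let b := Module.finBasis K ((Fin n → K) ⧸ W)
  let g : (Fin (Module.finrank K ((Fin n → K) ⧸ W)) → K) →ₗ[K] (Fin m → K) :=
    LinearMap.funLeft K K (Fin.castLE h3)
  have hg : Function.Surjective g :=
    LinearMap.funLeft_surjective_of_injective K K _ (Fin.castLE_injective h3)
  refine ⟨g ∘ₗ b.equivFun.toLinearMap ∘ₗ W.mkQ, ?_, fun i => ?_⟩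
  · rw [LinearMap.coe_comp, LinearMap.coe_comp]
    exact hg.comp (b.equivFun.surjective.comp (Submodule.mkQ_surjective W))
  · have : W.mkQ (l i) = 0 := by
      have h4 : l i ∈ W := Submodule.subset_span ⟨i, rfl⟩
      simpa using h4
    simp only [LinearMap.comp_apply, this, map_zero]

/-- the geometric input -/
lemma exists_section (k : Type) [Field k] (n d : ℕ) (I : Ideal (MvPolynomial (Fin n) k))
    (hd : 1 ≤ d)
    (hgen : ∃ G : Set (MvPolynomial (Fin n) k),
      (∀ g ∈ G, MvPolynomial.IsHomogeneous g d) ∧ Ideal.span G = I)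
    (m : ℕ) (hht : (m : ℕ∞) ≤ idealHeight I) :
    ∃ (K : Type) (_ : Field K) (φ : MvPolynomial (Fin n) k →+* MvPolynomial (Fin m) K) (N : ℕ),
      (∀ f e, f.IsHomogeneous e → (φ f).IsHomogeneous e) ∧ 1 ≤ N ∧
      ∀ a, (X a : MvPolynomial (Fin m) K) ^ N ∈ I.map φ := by
  let K := AlgebraicClosure k
  have : Infinite K := IsAlgClosed.instInfinite
  obtain ⟨G, hG, rfl⟩ := hgen
  have hprime : ∀ P : Ideal (MvPolynomial (Fin n) k), P.IsPrime → Ideal.span G ≤ P →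
      (m : ℕ∞) ≤ P.height := by
    intro P hP hle
    refine hht.trans ((iInf₂_le (⟨P, hP⟩ : PrimeSpectrum _) hle).trans ?_)
    exact (PrimeSpectrum.height_eq_orderHeight ⟨P, hP⟩).ge
  have hmn : m ≤ n := by
    have hk : (RingHom.ker (constantCoeff : MvPolynomial (Fin n) k →+* k)).IsPrime :=
      RingHom.ker_isPrime _
    have := (hprime _ hk (by
      rw [Ideal.span_le]
      intro g hg
      simp only [SetLike.mem_coe, RingHom.mem_ker, constantCoeff_eq]
      exact (hG g hg).coeff_eq_zero (by simp; omega))).trans (height_ker_le k n)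
    exact_mod_cast this
  let ι := MvPolynomial.map (σ := Fin n) (algebraMap k K)
  set J := (Ideal.span G).map ι with hJ
  obtain ⟨l, hl⟩ := avoid_many K n J m (fun P hP hle => Or.inr
    ((hprime _ (Ideal.comap_isPrime ι P) (Ideal.map_le_iff_le_comap.1 hle)).trans
      (height_comap_le' k K n P))) (n - m)
  rw [Nat.add_sub_cancel' hmn] at hl
  have hhom : (J ⊔ Ideal.span (Set.range fun i => lin K n (l i))).IsHomogeneous
      (homogeneousSubmodule (Fin n) K) := by
    refine Ideal.IsHomogeneous.sup ?_ ?_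
    · rw [hJ, Ideal.map_span]
      refine Ideal.homogeneous_span _ _ ?_
      rintro _ ⟨g, hg, rfl⟩
      exact ⟨d, (hG g hg).map _⟩
    · refine Ideal.homogeneous_span _ _ ?_
      rintro _ ⟨i, rfl⟩
      exact ⟨1, lin_hom _ _ _⟩
  obtain ⟨θ, hθ, hθl⟩ := exists_quot K n m (n - m) (by omega) l
  let ψ : MvPolynomial (Fin n) K →ₐ[K] MvPolynomial (Fin m) K :=
    aeval fun i => lin K m (θ (Pi.single i 1))
  have hψ : ∀ a, ψ (lin K n a) = lin K m (θ a) := by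
    intro a
    have : ψ.toLinearMap ∘ₗ lin K n = lin K m ∘ₗ θ := by
      apply LinearMap.pi_ext'
      intro i
      ext : 1
      simp [lin_single, ψ]
    exact LinearMap.congr_fun this a
  have key : ∀ a : Fin m, ∃ N, (X a : MvPolynomial (Fin m) K) ^ N ∈
      (Ideal.span G).map (ψ.toRingHom.comp ι) := by
    intro a
    obtain ⟨v, hv⟩ := hθ (Pi.single a 1)
    obtain ⟨N, hN⟩ := lin_pow_mem K n _ hhom hl v
    refine ⟨N, ?_⟩
    have h1 := Ideal.mem_map_of_mem ψ.toRingHom hN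
    have h2 : ψ.toRingHom (lin K n v ^ N) = X a ^ N := by
      rw [map_pow]; congr 1
      exact (hψ v).trans (by rw [hv, lin_single])
    rw [h2, Ideal.map_sup, hJ, Ideal.map_map] at h1
    refine (sup_le (le_refl ((Ideal.span G).map (ψ.toRingHom.comp ι))) ?_ :
      _ ⊔ Ideal.map ψ.toRingHom (Ideal.span (Set.range fun i => lin K n (l i))) ≤ _) h1
    rw [Ideal.map_span, Ideal.span_le]
    rintro _ ⟨_, ⟨i, rfl⟩, rfl⟩
    have : ψ.toRingHom (lin K n (l i)) = 0 := (hψ _).trans (by rw [hθl, map_zero])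
    simp only [this]
    exact Ideal.zero_mem _
  choose N hN using key
  refine ⟨K, inferInstance, ψ.toRingHom.comp ι, ∑ a, N a + 1, ?_, by omega, fun a => ?_⟩
  · intro f e hf
    have := (hf.map (algebraMap k K)).aeval (fun i => lin K m (θ (Pi.single i 1))) (n := 1)
      (fun i => lin_hom _ _ _)
    rwa [one_mul] at this
  · have : N a ≤ ∑ a, N a + 1 :=
      (Finset.single_le_sum (f := N) (fun _ _ => Nat.zero_le _) (Finset.mem_univ a)).trans
        (Nat.le_succ _)
    exact Ideal.pow_mem_of_pow_mem _ (hN a) this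

end NdqAux
namespace NdqAux
open MvPolynomial

/-- homogeneous of integer degree `w` -/
def IsH {K : Type} [Field K] {m : ℕ} (w : ℤ) (f : MvPolynomial (Fin m) K) : Prop :=
  ∀ α, coeff α f ≠ 0 → (α.degree : ℤ) = w

/-- homogeneous component of integer degree -/
noncomputable def hc {K : Type} [Field K] {m : ℕ} (w : ℤ) (f : MvPolynomial (Fin m) K) :
    MvPolynomial (Fin m) K :=
  if 0 ≤ w then homogeneousComponent w.toNat f else 0

section
variable {K : Type} [Field K] {m : ℕ}

lemma coeff_hc (w : ℤ) (f : MvPolynomial (Fin m) K) (α : Fin m →₀ ℕ) :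
    coeff α (hc w f) = if (α.degree : ℤ) = w then coeff α f else 0 := by
  unfold hc
  split_ifs with h1 h2 h2
  · rw [coeff_homogeneousComponent, if_pos (by omega)]
  · rw [coeff_homogeneousComponent, if_neg (by omega)]
  · omega
  · simp

lemma isH_hc (w : ℤ) (f : MvPolynomial (Fin m) K) : IsH w (hc w f) := by
  intro α h
  rw [coeff_hc] at h
  by_contra hh
  simp [hh] at h

lemma hc_self {w : ℤ} {f : MvPolynomial (Fin m) K} (h : IsH w f) : hc w f = f := by
  ext α
  rw [coeff_hc]
  split_ifs with h1
  · rfl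
  · by_contra hh
    exact h1 (h α (Ne.symm hh))

lemma hc_add (w : ℤ) (f g : MvPolynomial (Fin m) K) : hc w (f + g) = hc w f + hc w g := by
  ext α
  simp only [coeff_hc, coeff_add]
  split_ifs <;> simp

lemma hc_zero (w : ℤ) : hc w (0 : MvPolynomial (Fin m) K) = 0 := by
  ext α
  simp [coeff_hc]

lemma hc_sum {ι : Type*} (s : Finset ι) (w : ℤ) (f : ι → MvPolynomial (Fin m) K) :
    hc w (∑ i ∈ s, f i) = ∑ i ∈ s, hc w (f i) := by
  classical
  induction s using Finset.induction_on with
  | empty => simp [hc_zero]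
  | insert a s ha ih => rw [Finset.sum_insert ha, Finset.sum_insert ha, hc_add, ih]

lemma hc_mul {v : ℤ} {p : MvPolynomial (Fin m) K} (hp : IsH v p) (w : ℤ)
    (f : MvPolynomial (Fin m) K) : hc w (p * f) = p * hc (w - v) f := by
  ext α
  rw [coeff_hc, coeff_mul, coeff_mul]
  have hdeg : ∀ x ∈ Finset.HasAntidiagonal.antidiagonal α,
      (x.1.degree : ℤ) + x.2.degree = α.degree := by
    intro x hx
    rw [← Finset.HasAntidiagonal.mem_antidiagonal.1 hx, map_add]
    push_cast; ring
  split_ifs with h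
  · refine Finset.sum_congr rfl fun x hx => ?_
    by_cases h0 : coeff x.1 p = 0
    · simp [h0]
    · have := hp _ h0
      have := hdeg x hx
      rw [coeff_hc, if_pos (by omega)]
  · symm
    refine Finset.sum_eq_zero fun x hx => ?_
    by_cases h0 : coeff x.1 p = 0
    · simp [h0]
    · have := hp _ h0
      have := hdeg x hx
      rw [coeff_hc, if_neg (by omega), mul_zero]

lemma isH_zero (w : ℤ) : IsH w (0 : MvPolynomial (Fin m) K) := by intro α h; simp at h

lemma IsH.mul {v w : ℤ} {p f : MvPolynomial (Fin m) K} (hp : IsH v p) (hf : IsH w f) :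
    IsH (v + w) (p * f) := by
  have := hc_mul hp (v + w) f
  rw [show v + w - v = w by ring, hc_self hf] at this
  rw [← this]
  exact isH_hc _ _

lemma IsH.sum {ι : Type*} (s : Finset ι) (w : ℤ) (f : ι → MvPolynomial (Fin m) K)
    (h : ∀ i ∈ s, IsH w (f i)) : IsH w (∑ i ∈ s, f i) := by
  have : hc w (∑ i ∈ s, f i) = ∑ i ∈ s, f i := by
    rw [hc_sum]
    exact Finset.sum_congr rfl fun i hi => hc_self (h i hi)
  rw [← this]
  exact isH_hc _ _

lemma isH_of_isHomogeneous {e : ℕ} {f : MvPolynomial (Fin m) K} (h : f.IsHomogeneous e) :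
    IsH (e : ℤ) f := by
  intro α hα
  by_contra hh
  exact hα (h.coeff_eq_zero (by exact_mod_cast hh))

/-- the monomial ideals `(x_a^N : a < j)` -/
noncomputable def JJ (K : Type) [Field K] (m N j : ℕ) : Ideal (MvPolynomial (Fin m) K) :=
  Ideal.span ((fun s => monomial s (1 : K)) '' {s | ∃ a : Fin m, a.1 < j ∧ s = Finsupp.single a N})

lemma mem_JJ {N j : ℕ} {f : MvPolynomial (Fin m) K} :
    f ∈ JJ K m N j ↔ ∀ α, coeff α f ≠ 0 → ∃ a : Fin m, a.1 < j ∧ N ≤ α a := by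
  rw [JJ, mem_ideal_span_monomial_image]
  simp only [mem_support_iff, Set.mem_ofPred_eq]
  refine forall₂_congr fun α _ => ?_
  constructor
  · rintro ⟨_, ⟨a, ha, rfl⟩, h⟩
    exact ⟨a, ha, by simpa using h a⟩
  · rintro ⟨a, ha, h⟩
    exact ⟨_, ⟨a, ha, rfl⟩, by simpa using h⟩

lemma JJ_succ (N : ℕ) (a : Fin m) {f : MvPolynomial (Fin m) K} (hf : f ∈ JJ K m N (a.1 + 1)) :
    ∃ g ∈ JJ K m N a.1, ∃ w, f = g + X a ^ N * w := by
  have : JJ K m N (a.1 + 1) ≤ JJ K m N a.1 ⊔ Ideal.span {X a ^ N} := by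
    rw [JJ, Ideal.span_le]
    rintro _ ⟨_, ⟨b, hb, rfl⟩, rfl⟩
    rcases Nat.lt_succ_iff_lt_or_eq.1 hb with h | h
    · exact Ideal.mem_sup_left (Ideal.subset_span ⟨_, ⟨b, h, rfl⟩, rfl⟩)
    · refine Ideal.mem_sup_right (Ideal.subset_span ?_)
      have : b = a := Fin.ext h
      subst this
      simp [X_pow_eq_monomial]
  obtain ⟨g, hg, y, hy, rfl⟩ := Submodule.mem_sup.1 (this hf)
  obtain ⟨w, rfl⟩ := Ideal.mem_span_singleton'.1 hy
  exact ⟨g, hg, w, by ring⟩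

lemma JJ_mono (N j : ℕ) : JJ K m N j ≤ JJ K m N (j + 1) := by
  intro f hf
  rw [mem_JJ] at *
  intro α h
  obtain ⟨a, ha, h'⟩ := hf α h
  exact ⟨a, by omega, h'⟩

lemma X_mem_JJ (N : ℕ) (a : Fin m) : (X a ^ N : MvPolynomial (Fin m) K) ∈ JJ K m N (a.1 + 1) := by
  rw [X_pow_eq_monomial]
  exact Ideal.subset_span ⟨_, ⟨a, by omega, rfl⟩, rfl⟩

lemma JJ_reg (N : ℕ) (a : Fin m) {f : MvPolynomial (Fin m) K}
    (hf : X a ^ N * f ∈ JJ K m N a.1) : f ∈ JJ K m N a.1 := by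
  rw [mem_JJ] at *
  intro α h
  obtain ⟨b, hb, h'⟩ := hf (Finsupp.single a N + α) (by
    rw [X_pow_eq_monomial, coeff_monomial_mul, one_mul]; exact h)
  refine ⟨b, hb, ?_⟩
  have : a ≠ b := by rintro rfl; omega
  simpa [Finsupp.single_apply, this] using h'

lemma JJ_zero {N : ℕ} {f : MvPolynomial (Fin m) K} (hf : f ∈ JJ K m N 0) : f = 0 := by
  rw [mem_JJ] at hf
  ext α
  by_contra h
  obtain ⟨a, ha, _⟩ := hf α h
  omega

lemma JJ_top {N : ℕ} (hN : 1 ≤ N) {w : ℤ} {f : MvPolynomial (Fin m) K} (hf : IsH w f)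
    (hw : (m : ℤ) * N - m + 1 ≤ w) : f ∈ JJ K m N m := by
  rw [mem_JJ]
  intro α h
  by_contra! hh
  have h1 := hf α h
  have h2 : α.degree ≤ ∑ _a : Fin m, (N - 1) := by
    rw [Finsupp.degree_eq_sum]
    exact Finset.sum_le_sum fun a _ => by have := hh a a.2; omega
  simp only [Finset.sum_const, Finset.card_univ, Fintype.card_fin, smul_eq_mul] at h2
  have h3 : ((m * (N - 1) : ℕ) : ℤ) = m * N - m := by
    push_cast [Nat.cast_sub hN]; ring
  omega
end

section
variable {K : Type} [Field K] {m : ℕ} {B : ℕ → Type} [∀ i, Fintype (B i)] [∀ i, DecidableEq (B i)]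

/-- `s` is a homotopy for multiplication by `r` -/
def Hty {R : Type} [CommRing R]
    (D : ∀ i, Matrix (B i) (B (i + 1)) R) (r : R) (s : ∀ i, Matrix (B (i + 1)) (B i) R) : Prop :=
  D 0 * s 0 = r • 1 ∧ ∀ i, D (i + 1) * s (i + 1) + s i * D i = r • 1

/-- the ideal of nullhomotopic elements -/
def htyIdeal {R : Type} [CommRing R]
    (D : ∀ i, Matrix (B i) (B (i + 1)) R) : Ideal R where
  carrier := {r | ∃ s, Hty D r s}
  zero_mem' := ⟨fun _ => 0, by simp [Hty]⟩
  add_mem' := by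
    rintro a b ⟨s, h0, h1⟩ ⟨t, g0, g1⟩
    refine ⟨fun i => s i + t i, ?_, fun i => ?_⟩
    · rw [Matrix.mul_add, h0, g0, add_smul]
    · rw [Matrix.mul_add, Matrix.add_mul, add_smul, ← h1 i, ← g1 i]; abel
  smul_mem' := by
    rintro c a ⟨s, h0, h1⟩
    refine ⟨fun i => c • s i, ?_, fun i => ?_⟩
    · rw [Matrix.mul_smul, h0, smul_eq_mul, mul_smul]
    · rw [Matrix.mul_smul, Matrix.smul_mul, ← smul_add, h1 i, smul_eq_mul, mul_smul]

lemma exists_graded_hty (D : ∀ i, Matrix (B i) (B (i + 1)) (MvPolynomial (Fin m) K))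
    (deg : ∀ i, B i → ℤ) (hD : ∀ i b b', IsH (deg (i + 1) b' - deg i b) (D i b b'))
    (N : ℤ) (r : MvPolynomial (Fin m) K) (hr : IsH N r) (h : r ∈ htyIdeal D) :
    ∃ s, Hty D r s ∧ ∀ i b b', IsH (N + deg i b' - deg (i + 1) b) (s i b b') := by
  obtain ⟨s, h0, h1⟩ := h
  let s' : ∀ i, Matrix (B (i + 1)) (B i) (MvPolynomial (Fin m) K) :=
    fun i b b' => hc (N + deg i b' - deg (i + 1) b) (s i b b')
  have e1 : ∀ i b b', (D i * s' i) b b' = hc (N + deg i b' - deg i b) ((D i * s i) b b') := by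
    intro i b b'
    rw [Matrix.mul_apply, Matrix.mul_apply, hc_sum]
    refine Finset.sum_congr rfl fun x _ => ?_
    rw [hc_mul (hD i b x)]
    simp only [s']
    congr 2; ring
  have e2 : ∀ i b b', (s' i * D i) b b' =
      hc (N + deg (i + 1) b' - deg (i + 1) b) ((s i * D i) b b') := by
    intro i b b'
    rw [Matrix.mul_apply, Matrix.mul_apply, hc_sum]
    refine Finset.sum_congr rfl fun x _ => ?_
    rw [mul_comm, mul_comm (s i b x), hc_mul (hD i x b')]
    simp only [s']
    congr 2; ring
  have e3 : ∀ i (b b' : B i), hc (N + deg i b' - deg i b)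
      ((r • (1 : Matrix (B i) (B i) (MvPolynomial (Fin m) K))) b b') =
      (r • (1 : Matrix (B i) (B i) (MvPolynomial (Fin m) K))) b b' := by
    intro i b b'
    by_cases hb : b = b'
    · subst hb
      simpa using hc_self hr
    · simp [hb, hc_zero]
  refine ⟨s', ⟨?_, fun i => ?_⟩, fun i b b' => isH_hc _ _⟩
  · ext1 b b'
    rw [e1, h0, e3]
  · ext1 b b'
    rw [Matrix.add_apply, e1, e2, ← hc_add, ← Matrix.add_apply, h1 i, e3]

lemma mulVec_mem {R : Type} [CommRing R] {α β : Type} [Fintype β] (J : Ideal R) (A : Matrix α β R)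
    (z : β → R) (hz : ∀ b, z b ∈ J) (a : α) : (A.mulVec z) a ∈ J :=
  Ideal.sum_mem _ fun b _ => J.mul_mem_left _ (hz b)

lemma step_core (N : ℕ) (a : Fin m) {α β γ : Type} [Fintype α] [Fintype β] [Fintype γ]
    [DecidableEq α]
    (A : Matrix α β (MvPolynomial (Fin m) K)) (A' : Matrix β γ (MvPolynomial (Fin m) K))
    (hAA : A * A' = 0) (s : Matrix β α (MvPolynomial (Fin m) K))
    (z e : α → MvPolynomial (Fin m) K)
    (he : ∀ b, e b ∈ JJ K m N a.1)
    (hz : A.mulVec (s.mulVec z) + e = (X a ^ N : MvPolynomial (Fin m) K) • z)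
    (hP : ∃ v, ∀ b, (s.mulVec z - A'.mulVec v) b ∈ JJ K m N (a.1 + 1)) :
    ∃ v, ∀ b, (z - A.mulVec v) b ∈ JJ K m N a.1 := by
  obtain ⟨v, hv⟩ := hP
  choose g hg w hw using fun b => JJ_succ N a (hv b)
  refine ⟨w, fun b => JJ_reg N a ?_⟩
  have h1 : s.mulVec z = A'.mulVec v + g + (X a ^ N : MvPolynomial (Fin m) K) • w := by
    ext1 b
    have := hw b
    simp only [Pi.sub_apply, Pi.add_apply, Pi.smul_apply, smul_eq_mul] at this ⊢
    rw [add_assoc, ← this]; ring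
  rw [h1, Matrix.mulVec_add, Matrix.mulVec_add, Matrix.mulVec_mulVec, hAA, Matrix.zero_mulVec,
    Matrix.mulVec_smul, zero_add] at hz
  have h2 := congrFun hz b
  simp only [Pi.add_apply, Pi.smul_apply, smul_eq_mul] at h2
  have h3 : X a ^ N * (z - A.mulVec w) b = A.mulVec g b + e b := by
    rw [Pi.sub_apply, mul_sub, ← h2]; ring
  rw [h3]
  exact Ideal.add_mem _ (mulVec_mem _ _ _ hg b) (he b)

lemma main_alg (D : ∀ i, Matrix (B i) (B (i + 1)) (MvPolynomial (Fin m) K))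
    (hDD : ∀ i, D i * D (i + 1) = 0)
    (deg : ∀ i, B i → ℤ) (hD : ∀ i b b', IsH (deg (i + 1) b' - deg i b) (D i b b'))
    (N : ℕ) (hN : 1 ≤ N) (hX : ∀ a : Fin m, (X a : MvPolynomial (Fin m) K) ^ N ∈ htyIdeal D)
    (d : ℤ) (hdeg : ∀ b, deg m b ≤ d + m - 1) (hm : 1 ≤ m)
    (z : B 0 → MvPolynomial (Fin m) K) (hz : ∀ b, IsH (d - deg 0 b) (z b)) :
    ∃ v, z = (D 0).mulVec v := by
  have hXH : ∀ a : Fin m, IsH (N : ℤ) ((X a : MvPolynomial (Fin m) K) ^ N) := fun a =>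
    isH_of_isHomogeneous (isHomogeneous_X_pow a N)
  choose s hs hsd using fun a => exists_graded_hty D deg hD N _ (hXH a) (hX a)
  have hsz : ∀ (a : Fin m) (i : ℕ) (e : ℤ) (z : B i → MvPolynomial (Fin m) K),
      (∀ b, IsH (e - deg i b) (z b)) →
      ∀ b, IsH (e + N - deg (i + 1) b) ((s a i).mulVec z b) := by
    intro a i e z hz b
    refine IsH.sum _ _ _ fun x _ => ?_
    have := (hsd a i b x).mul (hz x)
    convert this using 1; ring
  have key : ∀ t j, j + 1 + t = m → ∀ z : B (j + 1) → MvPolynomial (Fin m) K,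
      (∀ b, IsH (d + (j + 1 : ℕ) * N - deg (j + 1) b) (z b)) →
      (∀ b, ((D j).mulVec z) b ∈ JJ K m N (j + 1)) →
      ∃ v, ∀ b, (z - (D (j + 1)).mulVec v) b ∈ JJ K m N (j + 1) := by
    intro t
    induction t with
    | zero =>
      intro j hj z hz _
      refine ⟨0, fun b => ?_⟩
      obtain rfl : m = j + 1 := by omega
      simp only [Matrix.mulVec_zero, sub_zero]
      refine JJ_top hN (hz b) ?_
      have := hdeg b
      linarith
    | succ t ih =>
      intro j hj z hz hcyc
      let a : Fin m := ⟨j + 1, by omega⟩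
      have e1 := congrArg (fun A => A.mulVec z) ((hs a).2 j)
      simp only [Matrix.add_mulVec, Matrix.smul_mulVec, Matrix.one_mulVec,
        ← Matrix.mulVec_mulVec] at e1
      have he : ∀ b, (s a j).mulVec ((D j).mulVec z) b ∈ JJ K m N a.1 := mulVec_mem _ _ _ hcyc
      refine step_core N a (D (j + 1)) (D (j + 2)) (hDD _) (s a (j + 1)) z _ he e1 ?_
      refine ih (j + 1) (by omega) _ ?_ ?_
      · intro b
        have := hsz a _ _ _ hz b
        convert this using 1
        push_cast; ring
      · intro b
        have e2 := congrFun e1 b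
        simp only [Pi.add_apply, Pi.smul_apply, smul_eq_mul] at e2
        rw [eq_sub_of_add_eq e2]
        exact Ideal.sub_mem _ (Ideal.mul_mem_right _ _ (X_mem_JJ N a)) (JJ_mono _ _ (he b))
  let a : Fin m := ⟨0, hm⟩
  have e1 := congrArg (fun A => A.mulVec z) (hs a).1
  simp only [Matrix.smul_mulVec, Matrix.one_mulVec, ← Matrix.mulVec_mulVec] at e1
  have := step_core N a (D 0) (D 1) (hDD _) (s a 0) z 0 (fun b => Ideal.zero_mem _)
    (by rw [add_zero, e1]) ?_
  · obtain ⟨v, hv⟩ := this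
    refine ⟨v, ?_⟩
    ext1 b
    exact sub_eq_zero.1 (JJ_zero (hv b))
  · refine key (m - 1) 0 (by omega) _ ?_ ?_
    · intro b
      have := hsz a _ _ _ hz b
      convert this using 1
      push_cast; ring
    · intro b
      rw [e1]
      exact Ideal.mul_mem_right _ _ (X_mem_JJ N a)
end

/-- dimension count -/
lemma dim_count {K : Type} [Field K] {m : ℕ} (hm : 1 ≤ m) (d : ℕ) {β : Type} [Fintype β]
    (g : β → MvPolynomial (Fin m) K) (hg : ∀ b, IsH (d : ℤ) (g b))
    (h : ∀ f : MvPolynomial (Fin m) K, IsH (d : ℤ) f → ∃ v : β → _, f = ∑ b, g b * v b) :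
    Nat.choose (d + m - 1) (m - 1) ≤ Fintype.card β := by
  classical
  have hspan : ∀ f : MvPolynomial (Fin m) K, IsH (d : ℤ) f →
      f ∈ Submodule.span K (Set.range g) := by
    intro f hf
    obtain ⟨v, hv⟩ := h f hf
    have h1 : f = ∑ b, coeff 0 (v b) • g b := by
      conv_lhs => rw [← hc_self hf, hv, hc_sum]
      refine Finset.sum_congr rfl fun b _ => ?_
      rw [hc_mul (hg b), sub_self, hc, if_pos le_rfl, Int.toNat_zero, homogeneousComponent_zero,
        smul_eq_C_mul, mul_comm]
    rw [h1]
    exact Submodule.sum_mem _ fun b _ => Submodule.smul_mem _ _ (Submodule.subset_span ⟨b, rfl⟩)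
  let A := (Finset.univ : Finset (Fin m)).finsuppAntidiag d
  have hA : A.card = Nat.choose (d + m - 1) (m - 1) := by
    rw [Finset.card_finsuppAntidiag_nat_eq_choose, Finset.card_univ, Fintype.card_fin,
      add_comm m d]
    rw [← Nat.choose_symm (by omega)]
    congr 1; omega
  have hli : LinearIndependent K (fun α : A => (monomial α.1 (1 : K) : MvPolynomial (Fin m) K)) :=
    by
      have := (basisMonomials (Fin m) K).linearIndependent.comp (Subtype.val : A → _)
        Subtype.val_injective
      rw [coe_basisMonomials] at this
      exact this
  have h1 := finrank_span_eq_card hli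
  rw [Fintype.card_coe, hA] at h1
  rw [← h1]
  have : FiniteDimensional K (Submodule.span K (Set.range g)) :=
    FiniteDimensional.span_of_finite K (Set.finite_range g)
  refine (Submodule.finrank_mono (t := Submodule.span K (Set.range g)) ?_).trans
    (finrank_range_le_card (R := K) g)
  rw [Submodule.span_le]
  rintro _ ⟨α, rfl⟩
  refine hspan _ (isH_of_isHomogeneous (isHomogeneous_monomial _ ?_))
  have := (Finset.mem_finsuppAntidiag.1 α.2).1
  rw [Finsupp.degree_eq_sum]
  exact this

end NdqAux
namespace NdqAux
open MvPolynomial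

section
variable {A : Type} [CommRing A] {hom : ℕ → Set A} {M : Type} [AddCommGroup M] [Module A M]

/-- index set of the basis of the `i`-th module -/
abbrev BB (res : MinGradedFreeRes A hom M) (i : ℕ) : Type := (j : ℤ) × Fin (res.β i j)

noncomputable instance instFinBB (res : MinGradedFreeRes A hom M) (i : ℕ) : Fintype (BB res i) where
  elems := (res.finβ i).toFinset.sigma (fun _ => Finset.univ)
  complete := by
    rintro ⟨j, a⟩
    have : res.β i j ≠ 0 := by
      intro h
      rw [h] at a
      exact a.elim0
    simpa using this

lemma card_BB (res : MinGradedFreeRes A hom M) (i : ℕ) : Fintype.card (BB res i) = res.tB i := by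
  rw [Fintype.card]
  change Finset.card ((res.finβ i).toFinset.sigma (fun _ => Finset.univ)) = _
  rw [Finset.card_sigma]
  simp [MinGradedFreeRes.tB]

/-- matrix of the differential -/
noncomputable def DM (res : MinGradedFreeRes A hom M) (i : ℕ) :
    Matrix (BB res i) (BB res (i + 1)) A :=
  LinearMap.toMatrix Finsupp.basisSingleOne Finsupp.basisSingleOne (res.d i)

lemma DM_apply (res : MinGradedFreeRes A hom M) (i : ℕ) (b : BB res i) (b' : BB res (i + 1)) :
    DM res i b b' = res.d i (Finsupp.single b' 1) b := by
  simp [DM, LinearMap.toMatrix_apply]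

lemma d_comp (res : MinGradedFreeRes A hom M) (i : ℕ) : res.d i ∘ₗ res.d (i + 1) = 0 :=
  LinearMap.range_le_ker_iff.1 (res.exact i).le

lemma DM_mul (res : MinGradedFreeRes A hom M) (i : ℕ) : DM res i * DM res (i + 1) = 0 := by
  rw [DM, DM, ← LinearMap.toMatrix_comp, d_comp, map_zero]

lemma lift_free {ι : Type} {F G : Type} [AddCommGroup F] [Module A F] [AddCommGroup G] [Module A G]
    (f : (ι →₀ A) →ₗ[A] G) (p : F →ₗ[A] G) (h : ∀ x, f x ∈ LinearMap.range p) :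
    ∃ s : (ι →₀ A) →ₗ[A] F, p ∘ₗ s = f := by
  choose y hy using fun i => h (Finsupp.single i 1)
  refine ⟨Finsupp.linearCombination A y, ?_⟩
  ext i
  simp [hy]

lemma mem_hty (res : MinGradedFreeRes A hom M) (g : A) (hg : ∀ x : M, g • x = 0) :
    g ∈ htyIdeal (DM res) := by
  have h0 : ∃ s : FreeMod A (res.β 0) →ₗ[A] FreeMod A (res.β 1),
      res.d 0 ∘ₗ s = g • LinearMap.id := by
    refine lift_free _ _ fun x => ?_
    rw [res.exact₀, LinearMap.mem_ker]
    simp [hg]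
  obtain ⟨s0, hs0⟩ := h0
  let T : ∀ i : ℕ, Type := fun i =>
    {s : FreeMod A (res.β i) →ₗ[A] FreeMod A (res.β (i + 1)) //
      res.d i ∘ₗ s ∘ₗ res.d i = g • res.d i}
  have hstep : ∀ i (s : T i), ∃ s' : T (i + 1),
      res.d (i + 1) ∘ₗ s'.1 + s.1 ∘ₗ res.d i = g • LinearMap.id := by
    rintro i ⟨s, hs⟩
    obtain ⟨s', hs'⟩ := lift_free (g • LinearMap.id - s ∘ₗ res.d i) (res.d (i + 1)) (fun x => by
      rw [res.exact, LinearMap.mem_ker]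
      have := LinearMap.congr_fun hs x
      simp only [LinearMap.comp_apply, LinearMap.smul_apply] at this
      simp [this])
    have hx : ∀ x, res.d (i + 1) (s' x) = g • x - s (res.d i x) := fun x =>
      LinearMap.congr_fun hs' x
    refine ⟨⟨s', ?_⟩, ?_⟩
    · refine LinearMap.ext fun x => ?_
      have h2 : res.d i (res.d (i + 1) x) = 0 := LinearMap.congr_fun (d_comp res i) x
      change res.d (i + 1) (s' (res.d (i + 1) x)) = g • res.d (i + 1) x
      rw [hx, h2, map_zero, sub_zero]
    · refine LinearMap.ext fun x => ?_
      change res.d (i + 1) (s' x) + s (res.d i x) = g • x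
      rw [hx, sub_add_cancel]
  choose nx hnx using hstep
  let S : ∀ i, T i := fun i => Nat.rec ⟨s0, by rw [← LinearMap.comp_assoc, hs0]; rfl⟩ nx i
  refine ⟨fun i => LinearMap.toMatrix Finsupp.basisSingleOne Finsupp.basisSingleOne (S i).1, ?_, ?_⟩
  · rw [DM, ← LinearMap.toMatrix_comp]
    change LinearMap.toMatrix _ _ (res.d 0 ∘ₗ s0) = _
    rw [hs0, map_smul, LinearMap.toMatrix_id]
  · intro i
    rw [DM, DM, ← LinearMap.toMatrix_comp, ← LinearMap.toMatrix_comp, ← map_add]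
    change LinearMap.toMatrix _ _ (res.d (i + 1) ∘ₗ (nx i (S i)).1 + (S i).1 ∘ₗ res.d i) = _
    rw [hnx, map_smul, LinearMap.toMatrix_id]

end

lemma map_hty {R R' : Type} [CommRing R] [CommRing R'] (φ : R →+* R') {B : ℕ → Type}
    [∀ i, Fintype (B i)] [∀ i, DecidableEq (B i)] (D : ∀ i, Matrix (B i) (B (i + 1)) R)
    (r : R) (hr : r ∈ htyIdeal D) : φ r ∈ htyIdeal (fun i => (D i).map φ) := by
  obtain ⟨s, h0, h1⟩ := hr
  have e : ∀ i, (r • (1 : Matrix (B i) (B i) R)).map φ = φ r • 1 := by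
    intro i
    ext b b'
    by_cases hb : b = b'
    · subst hb; simp
    · simp [hb]
  refine ⟨fun i => (s i).map φ, ?_, fun i => ?_⟩
  · rw [← Matrix.map_mul, h0, e]
  · rw [← Matrix.map_mul, ← Matrix.map_mul, ← e, ← h1 i, Matrix.map_add _ (map_add φ)]

end NdqAux

/-- Let `I ⊂ S` be a homogeneous ideal of height `c ≥ 2` generated in
degree `d` satisfying condition `N_{d,q}` (the minimal graded free resolution of `S/I` is
`d`-linear up to homological step `q`: `t_i^S(S/I) = d + i − 1` for `1 ≤ i ≤ q`).
Set `c' = min c q`.  Then `μ(I) ≥ C(d + c' − 1, c' − 1)`. -/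
theorem mu_lower_bound_of_Ndq
    (k : Type) [Field k] (n : ℕ) (I : Ideal (MvPolynomial (Fin n) k)) (d : ℕ)
    (hgen : ∃ G : Set (MvPolynomial (Fin n) k),
      (∀ g ∈ G, MvPolynomial.IsHomogeneous g d) ∧ Ideal.span G = I)
    (res : MinGradedFreeRes (MvPolynomial (Fin n) k)
      (fun m => {f | MvPolynomial.IsHomogeneous f m})
      (MvPolynomial (Fin n) k ⧸ I))
    (h0 : ∀ j : ℤ, res.β 0 j = if j = 0 then 1 else 0)
    (h1 : ∀ j : ℤ, res.β 1 j ≠ 0 → j = (d : ℤ))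
    (p : ℕ) (hlen : ∀ i, p < i → res.β i = 0) (hp : res.β p ≠ 0)
    (c : ℕ) (hc : 2 ≤ c) (hht : idealHeight I = (c : ℕ∞))
    (q : ℕ) (hq : 1 ≤ q)
    (hN : ∀ i : ℕ, 1 ≤ i → i ≤ q →
      (∀ j : ℤ, res.β i j ≠ 0 → j ≤ (d : ℤ) + i - 1) ∧ res.β i ((d : ℤ) + i - 1) ≠ 0) :
    Nat.choose (d + min c q - 1) (min c q - 1) ≤ res.tB 1 := by
  classical
  rcases Nat.eq_zero_or_pos d with hd | hd
  · subst hd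
    rw [zero_add, Nat.choose_self]
    have h := (hN 1 le_rfl hq).2
    rw [← NdqAux.card_BB, Nat.succ_le_iff, Fintype.card_pos_iff]
    exact ⟨⟨_, ⟨0, Nat.pos_of_ne_zero h⟩⟩⟩
  obtain ⟨m, hm⟩ : ∃ m, m = min c q := ⟨_, rfl⟩
  have hm1 : 1 ≤ m := by omega
  have hmq : m ≤ q := by omega
  have hmc : m ≤ c := by omega
  rw [← hm]
  obtain ⟨K, _, φ, N, hφ, hN1, hX⟩ := NdqAux.exists_section k n d I hd hgen m
    (by rw [hht]; exact_mod_cast hmc)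
  let D : ∀ i, Matrix (NdqAux.BB res i) (NdqAux.BB res (i + 1)) (MvPolynomial (Fin m) K) :=
    fun i => (NdqAux.DM res i).map φ
  have hDD : ∀ i, D i * D (i + 1) = 0 := by
    intro i
    rw [← Matrix.map_mul, NdqAux.DM_mul]
    ext1 b b'
    simp
  let deg : ∀ i, NdqAux.BB res i → ℤ := fun i b => b.1
  have hD : ∀ i b b', NdqAux.IsH (deg (i + 1) b' - deg i b) (D i b b') := by
    rintro i ⟨j', a'⟩ ⟨j, a⟩
    simp only [D, Matrix.map_apply, NdqAux.DM_apply, deg]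
    rcases res.graded i j a j' a' with h | ⟨e, he, h⟩
    · rw [h, map_zero]; exact NdqAux.isH_zero _
    · rw [← he]
      exact NdqAux.isH_of_isHomogeneous (hφ _ _ h)
  have hIle : I.map φ ≤ NdqAux.htyIdeal D := by
    rw [Ideal.map_le_iff_le_comap]
    intro g hg
    refine NdqAux.map_hty φ (NdqAux.DM res) g (NdqAux.mem_hty res g fun x => ?_)
    obtain ⟨y, rfl⟩ := Ideal.Quotient.mk_surjective x
    rw [← Ideal.Quotient.mk_eq_mk, ← Submodule.Quotient.mk_smul, Submodule.Quotient.mk_eq_zero,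
      smul_eq_mul]
    exact I.mul_mem_right _ hg
  have ne_of : ∀ i (b : NdqAux.BB res i), res.β i b.1 ≠ 0 := by
    rintro i ⟨j, a⟩ h
    have h' : res.β i j = 0 := h
    rw [h'] at a
    exact a.elim0
  have hdeg0 : ∀ b : NdqAux.BB res 0, deg 0 b = 0 := by
    intro b
    have := ne_of 0 b
    rw [h0] at this
    by_contra hb
    exact this (if_neg hb)
  have hdegm : ∀ b, deg m b ≤ (d : ℤ) + m - 1 := fun b =>
    (hN m hm1 hmq).1 _ (ne_of m b)
  let b0 : NdqAux.BB res 0 := ⟨0, ⟨0, by rw [h0]; simp⟩⟩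
  rw [← NdqAux.card_BB]
  refine NdqAux.dim_count (K := K) hm1 d (fun b => D 0 b0 b) (fun b => ?_) (fun f hf => ?_)
  · have := hD 0 b0 b
    rw [hdeg0, sub_zero] at this
    rwa [show deg (0 + 1) b = d from h1 _ (ne_of 1 b)] at this
  · obtain ⟨v, hv⟩ := NdqAux.main_alg D hDD deg hD N hN1 (fun a => hIle (hX a)) d hdegm hm1
      (fun _ => f) (fun b => by rw [hdeg0, sub_zero]; exact hf)
    exact ⟨v, congrFun hv b0⟩
end
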